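/- Let T be a tile system in the Moore neighborhood N_M, with finite set of glues X. There exist a finite glue set X_μ, a tile system T_μ in neighborhood N_vN over X_μ, a scale s ≥ 1, a polyomino assignment φ of scale s from T to finite T_μ-ribbons, and a zipper-simulation ψ of T by T_μ; in particular every (T,N_M)-zipper is simulated by some T_μ-ribbon. -/

import Mathlib

namespace Paper

open scoped Classical

abbrev Pos : Type := ℤ × ℤ

/-- The von Neumann neighborhood. -/
def Nvn : Set Pos := {(0, 1), (1, 0), (0, -1), (-1, 0)}

/-- A neighborhood: a finite symmetric set of positions not containing the origin. -/
def IsNeighborhood (N : Set Pos) : Prop :=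
  N.Finite ∧ (0, 0) ∉ N ∧ ∀ w ∈ N, -w ∈ N

/-- A tile over glues `X` and neighborhood `N` : a function from `N` to `X`. -/
abbrev Tile (X : Type) (N : Set Pos) : Type := {w : Pos // w ∈ N} → X

/-- Scaling a position by an integer. -/
def sc (s : ℤ) (u : Pos) : Pos := (s * u.1, s * u.2)

/-- Domain of a partial map on the plane. -/
def tdom {α : Type} (τ : Pos → Option α) : Set Pos := {p | τ p ≠ none}

/-- A (T,N)-tiling: a partial map to tiles of `T` such that all neighboring glues match. -/
def IsTiling {X : Type} {N : Set Pos} (T : Set (Tile X N))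
    (τ : Pos → Option (Tile X N)) : Prop :=
  (∀ p t, τ p = some t → t ∈ T) ∧
  (∀ p t, τ p = some t → ∀ w t', τ (p + w) = some t' →
    ∀ (hw : w ∈ N) (hw' : -w ∈ N), t ⟨w, hw⟩ = t' ⟨-w, hw'⟩)

def IsFiniteTiling {X : Type} {N : Set Pos} (T : Set (Tile X N))
    (τ : Pos → Option (Tile X N)) : Prop :=
  IsTiling T τ ∧ (tdom τ).Finite

/-- A partial map on the plane is total if it is defined everywhere. -/
def TotalDom {α : Type} (τ : Pos → Option α) : Prop := ∀ p, τ p ≠ none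

/-- A poly-tiling of scale `s`: a partial map from grid positions to finite tilings,
satisfying (i) each component is a finite tiling, (ii) translated domains are disjoint,
(iii) neighboring (after translation) tiles of two components have matching glues. -/
def IsPolyTiling {X : Type} {N : Set Pos} (T : Set (Tile X N)) (s : ℤ)
    (σ : Pos → Option (Pos → Option (Tile X N))) : Prop :=
  (∀ u τu, σ u = some τu → IsFiniteTiling T τu) ∧
  (∀ u v τu τv, u ≠ v → σ u = some τu → σ v = some τv →
    ∀ p, τu p ≠ none → ∀ q, τv q ≠ none → sc s u + p ≠ sc s v + q) ∧
  (∀ u u' τu τu', σ u = some τu → σ u' = some τu' →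
    ∀ v t, τu v = some t → ∀ v' t', τu' v' = some t' →
    ∀ (hw : (sc s u' + v') - (sc s u + v) ∈ N)
      (hw' : -((sc s u' + v') - (sc s u + v)) ∈ N),
      t ⟨(sc s u' + v') - (sc s u + v), hw⟩ =
        t' ⟨-((sc s u' + v') - (sc s u + v)), hw'⟩)

/-- The tiling induced by a poly-tiling: position `s•u + v` carries the tile `σ u v`. -/
noncomputable def induced {α : Type} (s : ℤ) (σ : Pos → Option (Pos → Option α)) :
    Pos → Option α := fun p =>
  if h : ∃ t, ∃ u τu v, σ u = some τu ∧ τu v = some t ∧ p = sc s u + v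
    then some h.choose else none

/-- Periodicity of a (partial) tiling, with horizontal and vertical periods. -/
def PeriodicT {α : Type} (τ : Pos → Option α) : Prop :=
  ∃ ph pv : ℤ, 0 < ph ∧ 0 < pv ∧
    ∀ (p : Pos) (a b : ℤ), τ p ≠ none →
      τ (p.1 + a * ph, p.2 + b * pv) ≠ none →
      τ p = τ (p.1 + a * ph, p.2 + b * pv)

def LineConvex {α : Type} (τ : Pos → Option α) : Prop :=
  ∀ x₁ x₂ x y : ℤ, τ (x₁, y) ≠ none → τ (x₂, y) ≠ none →
    x₁ < x → x < x₂ → τ (x, y) ≠ none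

def ColumnConvex {α : Type} (τ : Pos → Option α) : Prop :=
  ∀ x y₁ y₂ y : ℤ, τ (x, y₁) ≠ none → τ (x, y₂) ≠ none →
    y₁ < y → y < y₂ → τ (x, y) ≠ none

/-- 4-connectedness of a set of positions. -/
def ConnectedDom (D : Set Pos) : Prop :=
  ∀ p ∈ D, ∀ q ∈ D, ∃ (n : ℕ) (c : ℕ → Pos), c 0 = p ∧ c n = q ∧
    (∀ k ≤ n, c k ∈ D) ∧ ∀ k < n, c (k + 1) - c k ∈ Nvn

/-- The connected linear neighborhood `N_n`. -/
def Nlin (n : ℤ) : Set Pos := {w | w.2 = 0 ∧ 0 < |w.1| ∧ |w.1| ≤ n}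

/-- The rectangular neighborhood `N_{m,n}`. -/
def Nrect (m n : ℤ) : Set Pos := {w | |w.1| ≤ m ∧ |w.2| ≤ n ∧ w ≠ (0, 0)}

/-- A set of consecutive integers. -/
def IsInterval (I : Set ℤ) : Prop :=
  ∀ a b c : ℤ, a ∈ I → c ∈ I → a ≤ b → b ≤ c → b ∈ I

/-- A path: a map from a set of consecutive integers to the plane, consecutive
positions being (von Neumann) adjacent. -/
def IsPath (I : Set ℤ) (P : ℤ → Pos) : Prop :=
  IsInterval I ∧ ∀ i : ℤ, i ∈ I → i + 1 ∈ I → P (i + 1) - P i ∈ Nvn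

/-- A T-tiled path: a path together with a map from its range to tiles of `T`. -/
def IsTiledPath {X : Type} {N : Set Pos} (T : Set (Tile X N)) (I : Set ℤ)
    (P : ℤ → Pos) (r : Pos → Option (Tile X N)) : Prop :=
  IsPath I P ∧ tdom r = P '' I ∧ ∀ p t, r p = some t → t ∈ T

/-- A T-ribbon: an injective tiled path in which consecutive tiles stick. -/
def IsRibbon {X : Type} (T : Set (Tile X Nvn)) (I : Set ℤ) (P : ℤ → Pos)
    (r : Pos → Option (Tile X Nvn)) : Prop :=
  IsTiledPath T I P r ∧ (∀ i ∈ I, ∀ j ∈ I, P i = P j → i = j) ∧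
  (∀ i : ℤ, i ∈ I → i + 1 ∈ I → ∀ t t', r (P i) = some t → r (P (i + 1)) = some t' →
    ∀ (hv : P (i + 1) - P i ∈ Nvn) (hv' : -(P (i + 1) - P i) ∈ Nvn),
      t ⟨P (i + 1) - P i, hv⟩ = t' ⟨-(P (i + 1) - P i), hv'⟩)

/-- A (T,N)-zipper: an injective tiled path whose tile map is a (T,N)-tiling. -/
def IsZipper {X : Type} {N : Set Pos} (T : Set (Tile X N)) (I : Set ℤ)
    (P : ℤ → Pos) (r : Pos → Option (Tile X N)) : Prop :=
  IsTiledPath T I P r ∧ (∀ i ∈ I, ∀ j ∈ I, P i = P j → i = j) ∧ IsTiling T r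

/-- Bundled T-ribbons (tile system in the von Neumann neighborhood). -/
structure Ribbon (X : Type) (T : Set (Tile X Nvn)) : Type where
  I : Set ℤ
  P : ℤ → Pos
  r : Pos → Option (Tile X Nvn)
  isRibbon : IsRibbon T I P r

/-- A poly-ribbon of scale `s` with macro path `(J, Q)` and components `ρ`. -/
def IsPolyRibbon {X : Type} {T : Set (Tile X Nvn)} (s : ℤ) (J : Set ℤ)
    (Q : ℤ → Pos) (ρ : Pos → Option (Ribbon X T)) : Prop :=
  IsPath J Q ∧ (∀ i ∈ J, ∀ j ∈ J, Q i = Q j → i = j) ∧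
  tdom ρ = Q '' J ∧
  (∀ u R, ρ u = some R → R.I.Finite ∧ R.I.Nonempty) ∧
  (∀ u v R S, u ≠ v → ρ u = some R → ρ v = some S →
    ∀ p, R.r p ≠ none → ∀ q, S.r q ≠ none → sc s u + p ≠ sc s v + q) ∧
  (∀ j : ℤ, j ∈ J → j + 1 ∈ J → ∀ R₁ R₂, ρ (Q j) = some R₁ → ρ (Q (j + 1)) = some R₂ →
    ∀ m₁, IsGreatest R₁.I m₁ → ∀ m₂, IsLeast R₂.I m₂ →
      ((sc s (Q (j + 1)) + R₂.P m₂) - (sc s (Q j) + R₁.P m₁) ∈ Nvn ∧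
      ∀ t₁ t₂, R₁.r (R₁.P m₁) = some t₁ → R₂.r (R₂.P m₂) = some t₂ →
        ∀ (hv : (sc s (Q (j + 1)) + R₂.P m₂) - (sc s (Q j) + R₁.P m₁) ∈ Nvn)
          (hv' : -((sc s (Q (j + 1)) + R₂.P m₂) - (sc s (Q j) + R₁.P m₁)) ∈ Nvn),
          t₁ ⟨(sc s (Q (j + 1)) + R₂.P m₂) - (sc s (Q j) + R₁.P m₁), hv⟩ =
            t₂ ⟨-((sc s (Q (j + 1)) + R₂.P m₂) - (sc s (Q j) + R₁.P m₁)), hv'⟩))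

/-- A zipper-simulation of `T` (in neighborhood `N`) by `Tμ` (in the von Neumann
neighborhood), of scale `s`, consisting of a polyomino assignment `phi`, the
trimming map `chi` and the simulation map `psi`. -/
structure ZipperSimulation (X Xμ : Type) (N : Set Pos) (T : Set (Tile X N))
    (Tμ : Set (Tile Xμ Nvn)) (s : ℤ) : Type where
  hs : 1 ≤ s
  phi : Tile X N → Set (Ribbon Xμ Tμ)
  phi_fin : ∀ t, ∀ R ∈ phi t, R.I.Finite ∧ R.I.Nonempty
  phi_ref : ∀ t, ∀ R ∈ phi t, R.r (0, 0) ≠ none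
  phi_spec : ∀ t t', t ≠ t' → ∀ R ∈ phi t, ∀ S ∈ phi t',
    ∀ p q a b, R.r p = some a → S.r q = some b → a ≠ b
  chi : Ribbon Xμ Tμ → Pos → Option (Ribbon Xμ Tμ)
  chi_poly : ∀ R : Ribbon Xμ Tμ, ∃ J Q, IsPolyRibbon s J Q (chi R)
  chi_sub : ∀ R u S, chi R u = some S →
    (∃ t ∈ T, S ∈ phi t) ∧ ∀ p a, S.r p = some a → R.r (sc s u + p) = some a
  chi_max : ∀ (R : Ribbon Xμ Tμ) (t : Tile X N), t ∈ T → ∀ S ∈ phi t, ∀ u : Pos,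
    (∀ p a, S.r p = some a → R.r (sc s u + p) = some a) → chi R u ≠ none
  psi : Set ℤ → (ℤ → Pos) → (Pos → Option (Tile X N)) → Set (Pos → Option (Ribbon Xμ Tμ))
  psi_nonempty : ∀ I P r, IsZipper T I P r → (psi I P r).Nonempty
  psi_poly : ∀ I P r, IsZipper T I P r → ∀ ρ ∈ psi I P r, IsPolyRibbon s I P ρ
  psi_comp : ∀ I P r, IsZipper T I P r → ∀ ρ ∈ psi I P r,
    ∀ u t, r u = some t → ∀ S, ρ u = some S → S ∈ phi t
  psi_exists : ∀ R : Ribbon Xμ Tμ, ∃ I P r, IsZipper T I P r ∧ chi R ∈ psi I P r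
  psi_unique : ∀ (R : Ribbon Xμ Tμ) I P r I' P' r',
    IsZipper T I P r → IsZipper T I' P' r' →
    chi R ∈ psi I P r → chi R ∈ psi I' P' r' →
    r = r' ∧ ∃ d : ℤ, (∀ i, i ∈ I ↔ i + d ∈ I') ∧ ∀ i ∈ I, P' (i + d) = P i

/-- A tiling-simulation of `T` (in neighborhood `N`) by `Tμ` (in the von Neumann
neighborhood), of scale `s`, consisting of a polyomino assignment `phi`, the
trimming map `chi` and the simulation map `psi`. -/
structure TilingSimulation (X Xμ : Type) (N : Set Pos) (T : Set (Tile X N))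
    (Tμ : Set (Tile Xμ Nvn)) (s : ℤ) : Type where
  hs : 1 ≤ s
  phi : Tile X N → Set (Pos → Option (Tile Xμ Nvn))
  phi_fin : ∀ t, ∀ τ' ∈ phi t, IsFiniteTiling Tμ τ'
  phi_ref : ∀ t, ∀ τ' ∈ phi t, τ' (0, 0) ≠ none
  phi_spec : ∀ t t', t ≠ t' → ∀ τ₁ ∈ phi t, ∀ τ₂ ∈ phi t',
    ∀ p q a b, τ₁ p = some a → τ₂ q = some b → a ≠ b
  chi : (Pos → Option (Tile Xμ Nvn)) → Pos → Option (Pos → Option (Tile Xμ Nvn))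
  chi_poly : ∀ τ', IsTiling Tμ τ' → IsPolyTiling Tμ s (chi τ')
  chi_sub : ∀ τ' u σu, chi τ' u = some σu →
    (∃ t ∈ T, σu ∈ phi t) ∧ ∀ p a, σu p = some a → τ' (sc s u + p) = some a
  chi_max : ∀ (τ' : Pos → Option (Tile Xμ Nvn)) (t : Tile X N), t ∈ T →
    ∀ σu ∈ phi t, ∀ u : Pos,
    (∀ p a, σu p = some a → τ' (sc s u + p) = some a) → chi τ' u ≠ none
  psi : (Pos → Option (Tile X N)) → Set (Pos → Option (Pos → Option (Tile Xμ Nvn)))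
  psi_nonempty : ∀ τ, IsTiling T τ → (psi τ).Nonempty
  psi_poly : ∀ τ, IsTiling T τ → ∀ σ ∈ psi τ, IsPolyTiling Tμ s σ
  psi_dom : ∀ τ, IsTiling T τ → ∀ σ ∈ psi τ, ∀ u, σ u ≠ none ↔ τ u ≠ none
  psi_comp : ∀ τ, IsTiling T τ → ∀ σ ∈ psi τ,
    ∀ u t, τ u = some t → ∀ σu, σ u = some σu → σu ∈ phi t
  psi_recover : ∀ τ', IsTiling Tμ τ' → ∃! τ, IsTiling T τ ∧ chi τ' ∈ psi τ

/-- Every set of integers is enumerated increasingly by an interval of integers. -/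
theorem exists_enumeration (H : Set ℤ) :
    ∃ (J : Set ℤ) (e : ℤ → ℤ), IsInterval J ∧ StrictMonoOn e J ∧ e '' J = H := by
  rcases H.eq_empty_or_nonempty with rfl | ⟨h₀, hh₀⟩
  · exact ⟨∅, id, fun a b c h => h.elim, fun a h => h.elim, by simp⟩
  let _ : LocallyFiniteOrder H := inferInstance
  let _ : SuccOrder H := LinearLocallyFiniteOrder.succOrder H
  let _ : PredOrder H := LinearLocallyFiniteOrder.predOrder H
  let i₀ : H := ⟨h₀, hh₀⟩
  let f : H → ℤ := toZ i₀
  have hf : StrictMono f := toZ_strictMono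
  have key : ∀ (z : H) (b : ℤ), (0 ≤ b → b ≤ f z → ∃ y, f y = b) ∧
      (b < 0 → f z ≤ b → ∃ y, f y = b) := by
    intro z b
    constructor
    · intro hb hbz
      have hz : i₀ ≤ z := by
        by_contra hlt
        have : f z < 0 := toZ_neg (not_le.mp hlt)
        omega
      by_cases hm : IsMax (Order.succ^[b.toNat] i₀)
      · refine ⟨z, le_antisymm ?_ hbz⟩
        have h1 : z = Order.succ^[(f z).toNat] i₀ := (iterate_succ_toZ z hz).symm
        have h2 : z ≤ Order.succ^[b.toNat] i₀ := by
          obtain ⟨k, hk⟩ : ∃ k, (f z).toNat = k + b.toNat := ⟨(f z).toNat - b.toNat, by omega⟩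
          rw [hk, Function.iterate_add_apply] at h1
          exact hm (by rw [h1]; exact Order.le_succ_iterate _ _)
        have h3 : f z ≤ f (Order.succ^[b.toNat] i₀) := hf.monotone h2
        have h4 : f (Order.succ^[b.toNat] i₀) ≤ (b.toNat : ℤ) := toZ_iterate_succ_le _
        omega
      · refine ⟨_, (toZ_iterate_succ_of_not_isMax b.toNat hm).trans ?_⟩
        omega
    · intro hb hbz
      have hz : z < i₀ := by
        by_contra hlt
        have : 0 ≤ f z := toZ_nonneg (not_lt.mp hlt)
        omega
      by_cases hm : IsMin (Order.pred^[(-b).toNat] i₀)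
      · refine ⟨z, le_antisymm hbz ?_⟩
        have h1 : z = Order.pred^[(-f z).toNat] i₀ := (iterate_pred_toZ z hz).symm
        have h2 : Order.pred^[(-b).toNat] i₀ ≤ z := by
          obtain ⟨k, hk⟩ : ∃ k, (-f z).toNat = k + (-b).toNat :=
            ⟨(-f z).toNat - (-b).toNat, by omega⟩
          rw [hk, Function.iterate_add_apply] at h1
          exact hm (by rw [h1]; exact Order.pred_iterate_le _ _)
        have h3 : f (Order.pred^[(-b).toNat] i₀) ≤ f z := hf.monotone h2
        have h4 : -((-b).toNat : ℤ) ≤ f (Order.pred^[(-b).toNat] i₀) := toZ_iterate_pred_ge _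
        omega
      · refine ⟨_, (toZ_iterate_pred_of_not_isMin (-b).toNat hm).trans ?_⟩
        omega
  let e : ℤ → ℤ := fun j => if h : ∃ y, f y = j then (h.choose : ℤ) else 0
  have he : ∀ y, e (f y) = y := by
    intro y
    have h : ∃ y', f y' = f y := ⟨y, rfl⟩
    have : h.choose = y := hf.injective h.choose_spec
    simp only [e, dif_pos h, this]
  refine ⟨Set.range f, e, ?_, ?_, ?_⟩
  · rintro a b c ⟨x, rfl⟩ ⟨z, rfl⟩ hab hbc
    rcases lt_or_ge b 0 with hb | hb
    · exact (key x b).2 hb hab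
    · exact (key z b).1 hb hbc
  · rintro _ ⟨x, rfl⟩ _ ⟨z, rfl⟩ hxz
    rw [he, he]
    exact hf.lt_iff_lt.mp hxz
  · ext y
    constructor
    · rintro ⟨_, ⟨x, rfl⟩, rfl⟩
      rw [he]; exact x.2
    · intro hy
      exact ⟨f ⟨y, hy⟩, ⟨_, rfl⟩, he _⟩

/-- Every sequence of increments indexed by the integers has a primitive. -/
theorem exists_primitive (f : ℤ → ℤ) : ∃ e : ℤ → ℤ, ∀ i, e (i + 1) = e i + f i := by
  refine ⟨fun i => ∑ k ∈ Finset.Ico 0 i, f k - ∑ k ∈ Finset.Ico i 0, f k, fun i => ?_⟩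
  beta_reduce
  rcases lt_or_ge i 0 with hi | hi
  · have h1 : Finset.Ico i 0 = insert i (Finset.Ico (i + 1) 0) := by
      ext k; simp only [Finset.mem_Ico, Finset.mem_insert]; omega
    have h2 : Finset.Ico 0 i = ∅ := Finset.Ico_eq_empty (by omega)
    have h3 : Finset.Ico 0 (i + 1) = ∅ := Finset.Ico_eq_empty (by omega)
    rw [h1, Finset.sum_insert (by simp), h2, h3]
    simp
  · have h1 : Finset.Ico 0 (i + 1) = insert i (Finset.Ico 0 i) := by
      ext k; simp only [Finset.mem_Ico, Finset.mem_insert]; omega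
    have h2 : Finset.Ico i 0 = ∅ := Finset.Ico_eq_empty (by omega)
    have h3 : Finset.Ico (i + 1) 0 = ∅ := Finset.Ico_eq_empty (by omega)
    rw [h1, Finset.sum_insert (by simp), h2, h3]
    ring

/-- A property carried over between consecutive elements of an interval holds everywhere. -/
theorem IsInterval.induction {I : Set ℤ} (hI : IsInterval I) {p : ℤ → Prop} {a : ℤ}
    (ha : a ∈ I) (h0 : p a) (hup : ∀ i, i ∈ I → i + 1 ∈ I → p i → p (i + 1))
    (hdown : ∀ i, i ∈ I → i + 1 ∈ I → p (i + 1) → p i) : ∀ i ∈ I, p i := by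
  have up : ∀ k : ℕ, a + k ∈ I → p (a + k) := by
    intro k
    induction k with
    | zero => intro _; simpa using h0
    | succ k ih =>
      intro hk
      have hk' : a + k ∈ I := hI a _ _ ha hk (by omega) (by push_cast; omega)
      have := hup _ hk' (by simpa [add_assoc] using hk) (ih hk')
      simpa [add_assoc] using this
  have down : ∀ k : ℕ, a - k ∈ I → p (a - k) := by
    intro k
    induction k with
    | zero => intro _; simpa using h0
    | succ k ih =>
      intro hk
      have hk' : a - k ∈ I := hI _ _ a hk ha (by push_cast; omega) (by omega)
      have e : a - ((k + 1 : ℕ) : ℤ) + 1 = a - k := by push_cast; ring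
      exact hdown _ hk (by rw [e]; exact hk') (by rw [e]; exact ih hk')
  intro i hi
  rcases le_total a i with h | h
  · have e : i = a + ((i - a).toNat : ℤ) := by omega
    rw [e] at hi ⊢; exact up _ hi
  · have e : i = a - ((a - i).toNat : ℤ) := by omega
    rw [e] at hi ⊢; exact down _ hi

/-- A strictly increasing bijection between intervals of integers is a translation. -/
theorem exists_shift {I I' : Set ℤ} (hI : IsInterval I) (g : ℤ → ℤ)
    (hg : ∀ i ∈ I, g i ∈ I') (hmono : ∀ i ∈ I, ∀ j ∈ I, i < j → g i < g j)
    (hI' : IsInterval I') (hsurj : ∀ j ∈ I', ∃ i ∈ I, g i = j) :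
    ∃ d : ℤ, (∀ i, i ∈ I ↔ i + d ∈ I') ∧ ∀ i ∈ I, g i = i + d := by
  rcases I.eq_empty_or_nonempty with rfl | ⟨a, ha⟩
  · refine ⟨0, fun i => ⟨fun h => h.elim, fun h => ?_⟩, fun i h => h.elim⟩
    obtain ⟨i, hi, -⟩ := hsurj _ h
    exact hi
  have step : ∀ i, i ∈ I → i + 1 ∈ I → g (i + 1) = g i + 1 := by
    intro i hi hi1
    have hlt := hmono i hi _ hi1 (by omega)
    by_contra hne
    obtain ⟨j, hj, hgj⟩ := hsurj (g i + 1)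
      (hI' (g i) _ (g (i + 1)) (hg i hi) (hg _ hi1) (by omega) (by omega))
    rcases lt_trichotomy j i with h | h | h
    · have := hmono j hj i hi h; omega
    · subst h; omega
    · rcases eq_or_lt_of_le (show i + 1 ≤ j by omega) with h' | h'
      · subst h'; omega
      · have := hmono _ hi1 j hj h'; omega
  have hall : ∀ i ∈ I, g i = i + (g a - a) := by
    refine hI.induction ha (by omega) ?_ ?_
    · intro i hi hi1 h; rw [step i hi hi1, h]; ring
    · intro i hi hi1 h; have := step i hi hi1; omega
  refine ⟨g a - a, fun i => ⟨fun h => hall i h ▸ hg i h, fun h => ?_⟩, hall⟩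
  obtain ⟨j, hj, hgj⟩ := hsurj _ h
  have := hall j hj
  have : j = i := by omega
  exact this ▸ hj

/-- Self-avoiding paths through a square cell of scale `s`, one for each variant in `V`.
The path of a variant enters the cell through its side `inD` and leaves it through its
side `outD`; on each side there is one entry point `st` and one exit point `en`. -/
structure CellPaths (V : Type) where
  s : ℤ
  hs : 1 ≤ s
  inD : V → Pos
  outD : V → Pos
  st : Pos → Pos
  en : Pos → Pos
  len : V → ℕ
  pos : V → ℕ → Pos
  inD_mem : ∀ v, inD v ∈ Nvn
  outD_mem : ∀ v, outD v ∈ Nvn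
  two_le_len : ∀ v, 2 ≤ len v
  pos_zero : ∀ v, pos v 0 = st (inD v)
  pos_last : ∀ v, pos v (len v - 1) = en (outD v)
  pos_step : ∀ v k, k + 1 < len v → pos v (k + 1) - pos v k ∈ Nvn
  pos_inj : ∀ v k l, k < len v → l < len v → pos v k = pos v l → k = l
  port : ∀ d ∈ Nvn, en d + d = sc s d + st (-d)
  st_out : ∀ v k, k < len v → pos v k ≠ st (inD v) + inD v
  en_out : ∀ v k, k < len v → pos v k ≠ en (outD v) + outD v
  origin : ∀ v, ∃ k < len v, pos v k = 0

theorem mem_Nvn_iff {w : Pos} : w ∈ Nvn ↔ w = (0, 1) ∨ w = (1, 0) ∨ w = (0, -1) ∨ w = (-1, 0) := by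
  simp [Nvn]

theorem neg_mem_Nvn {w : Pos} (h : w ∈ Nvn) : -w ∈ Nvn := by
  rw [mem_Nvn_iff] at *
  rcases h with rfl | rfl | rfl | rfl <;> simp

theorem ne_neg_of_mem_Nvn {w : Pos} (h : w ∈ Nvn) : w ≠ -w := by
  rw [mem_Nvn_iff] at h
  rcases h with rfl | rfl | rfl | rfl <;> simp

theorem finite_Nvn : Nvn.Finite := by
  simp [Nvn]

theorem exists_mem_Nvn_ne (a b : Pos) : ∃ w ∈ Nvn, w ≠ a ∧ w ≠ b := by
  by_contra! h
  have h1 := h (0, 1) (by simp [Nvn])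
  have h2 := h (1, 0) (by simp [Nvn])
  have h3 := h (0, -1) (by simp [Nvn])
  by_cases e1 : ((0, 1) : Pos) = a
  · subst e1
    have := (h2 (by simp)).trans (h3 (by simp)).symm
    simp at this
  · by_cases e2 : ((1, 0) : Pos) = a
    · subst e2
      have := (h1 (by simp)).trans (h3 (by simp)).symm
      simp at this
    · have := (h1 e1).trans (h2 e2).symm
      simp at this

namespace CellPaths

variable {V : Type} (M : CellPaths V)

/-- The positions inside the path of a variant. -/
abbrev State : Type := {q : V × ℕ // q.2 < M.len q.1}

instance [Finite V] : Finite M.State :=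
  Finite.of_injective
    (fun q : M.State => (⟨q.1.1, ⟨q.1.2, q.2⟩⟩ : Σ v, Fin (M.len v))) (by
      rintro ⟨⟨v, k⟩, hk⟩ ⟨⟨v', k'⟩, hk'⟩ h
      simp only [Sigma.mk.injEq] at h
      obtain ⟨rfl, h⟩ := h
      simpa using h)

/-- The point visited at a state. -/
def here (q : M.State) : Pos := M.pos q.1.1 q.1.2

/-- The point visited just after a state. -/
def next (q : M.State) : Pos :=
  if q.1.2 + 1 < M.len q.1.1 then M.pos q.1.1 (q.1.2 + 1)
  else M.en (M.outD q.1.1) + M.outD q.1.1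

/-- The point visited just before a state. -/
def prev (q : M.State) : Pos :=
  if q.1.2 = 0 then M.st (M.inD q.1.1) + M.inD q.1.1 else M.pos q.1.1 (q.1.2 - 1)

def outVec (q : M.State) : Pos := M.next q - M.here q

def inVec (q : M.State) : Pos := M.here q - M.prev q

theorem outVec_mem (q : M.State) : M.outVec q ∈ Nvn := by
  obtain ⟨⟨v, k⟩, hk : k < M.len v⟩ := q
  simp only [outVec, next, here] at *
  split_ifs with h
  · exact M.pos_step v k h
  · have : k = M.len v - 1 := by omega
    rw [this, M.pos_last, add_sub_cancel_left]
    exact M.outD_mem v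

theorem next_ne_prev (q : M.State) : M.next q ≠ M.prev q := by
  obtain ⟨⟨v, k⟩, hk : k < M.len v⟩ := q
  have h2 := M.two_le_len v
  simp only [next, prev] at *
  split_ifs with h h' h'
  · exact M.st_out v _ h
  · intro e
    have := M.pos_inj v _ _ h (by omega) e
    omega
  · omega
  · exact (M.en_out v (k - 1) (by omega)).symm

theorem outVec_ne (q : M.State) : M.outVec q ≠ -M.inVec q := by
  intro h
  apply M.next_ne_prev q
  simpa [outVec, inVec] using h

/-- Glues: a direction, and either a port, a link inside a path, or a dead end. -/
abbrev Glue : Type := {w : Pos // w ∈ Nvn} × Option (Bool × M.State)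

noncomputable def outLabel (q : M.State) : Option (Bool × M.State) :=
  if q.1.2 + 1 < M.len q.1.1 then some (true, q) else none

noncomputable def inLabel (q : M.State) : Option (Bool × M.State) :=
  if q.1.2 = 0 then none
  else some (true, ⟨(q.1.1, q.1.2 - 1), (Nat.sub_le _ _).trans_lt q.2⟩)

/-- The tile of a state. -/
noncomputable def tile (q : M.State) : Tile M.Glue Nvn := fun w =>
  if w.1 = M.outVec q then (w, M.outLabel q)
  else if -w.1 = M.inVec q then (⟨-w.1, neg_mem_Nvn w.2⟩, M.inLabel q)
  else (w, some (false, q))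

def tiles : Set (Tile M.Glue Nvn) := Set.range M.tile

/-- A path going through a state may move along `w` to another state. -/
def Step (q : M.State) (w : Pos) (q' : M.State) : Prop :=
  M.outVec q = w ∧ M.inVec q' = w ∧ M.outLabel q = M.inLabel q'

variable {M}

theorem outLabel_ne (q q' : M.State) : M.outLabel q ≠ some (false, q') := by
  unfold outLabel; split_ifs <;> simp

theorem inLabel_ne (q q' : M.State) : M.inLabel q ≠ some (false, q') := by
  unfold inLabel; split_ifs <;> simp

theorem tile_injective : Function.Injective M.tile := by
  intro q q' h
  obtain ⟨w, hw, h1, h2⟩ := exists_mem_Nvn_ne (M.outVec q) (-M.inVec q)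
  have h3 := congrFun h ⟨w, hw⟩
  have h2' : -w ≠ M.inVec q := fun e => h2 (by rw [← e, neg_neg])
  simp only [tile, if_neg h1, if_neg h2'] at h3
  split_ifs at h3
  · exact absurd (congrArg Prod.snd h3).symm (outLabel_ne _ _)
  · exact absurd (congrArg Prod.snd h3).symm (inLabel_ne _ _)
  · simpa using h3

theorem Step.glue {q q' : M.State} {w : Pos} (h : M.Step q w q') (hw : w ∈ Nvn)
    (hw' : -w ∈ Nvn) : M.tile q ⟨w, hw⟩ = M.tile q' ⟨-w, hw'⟩ := by
  obtain ⟨rfl, h2, h3⟩ := h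
  have h4 : -M.outVec q ≠ M.outVec q' := by
    rw [← h2]; exact (outVec_ne _ _).symm
  simp [tile, h2, h3, h4]

theorem tile_cases (q : M.State) (w : {w : Pos // w ∈ Nvn}) :
    (M.outVec q = w ∧ M.tile q w = (w, M.outLabel q)) ∨
    (M.inVec q = -w.1 ∧ M.tile q w = (⟨-w.1, neg_mem_Nvn w.2⟩, M.inLabel q)) ∨
    M.tile q w = (w, some (false, q)) := by
  unfold tile
  split_ifs with h h'
  · exact Or.inl ⟨h.symm, rfl⟩
  · exact Or.inr (Or.inl ⟨h'.symm, rfl⟩)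
  · exact Or.inr (Or.inr rfl)

theorem step_of_glue {q q' : M.State} {w : Pos} (hw : w ∈ Nvn) (hw' : -w ∈ Nvn)
    (h : M.tile q ⟨w, hw⟩ = M.tile q' ⟨-w, hw'⟩) : M.Step q w q' ∨ M.Step q' (-w) q := by
  have hne := ne_neg_of_mem_Nvn hw
  rcases tile_cases q ⟨w, hw⟩ with ⟨h1, h2⟩ | ⟨h1, h2⟩ | h2 <;>
  rcases tile_cases q' ⟨-w, hw'⟩ with ⟨h3, h4⟩ | ⟨h3, h4⟩ | h4 <;>
  rw [h2, h4] at h <;>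
  simp only [Prod.mk.injEq, Subtype.mk.injEq, neg_neg] at h
  · exact absurd h.1 hne
  · exact Or.inl ⟨h1, by simpa using h3, h.2⟩
  · exact absurd h.1 hne
  · exact Or.inr ⟨h3, h1, h.2.symm⟩
  · exact absurd h.1.symm hne
  · exact absurd h.2 (inLabel_ne _ _)
  · exact absurd h.1 hne
  · exact absurd h.2.symm (inLabel_ne _ _)
  · exact absurd h.1 hne

end CellPaths

theorem sc_add (s : ℤ) (u v : Pos) : sc s (u + v) = sc s u + sc s v := by
  simp [sc, mul_add]

theorem sc_injective {s : ℤ} (hs : 1 ≤ s) {u v : Pos} (h : sc s u = sc s v) : u = v := by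
  have hs' : s ≠ 0 := by omega
  simpa [sc, hs', Prod.ext_iff] using h

namespace CellPaths

variable {V : Type} {M : CellPaths V}

theorem Step.cases {q q' : M.State} {w : Pos} (h : M.Step q w q') :
    (q'.1 = (q.1.1, q.1.2 + 1) ∧ w = M.here q' - M.here q) ∨
    (q.1.2 + 1 = M.len q.1.1 ∧ q'.1.2 = 0 ∧ M.inD q'.1.1 = -M.outD q.1.1 ∧
      w = M.here q' - M.here q + sc M.s (M.outD q.1.1)) := by
  obtain ⟨⟨v, k⟩, hk : k < M.len v⟩ := q
  obtain ⟨⟨v', k'⟩, hk' : k' < M.len v'⟩ := q'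
  obtain ⟨h1, h2, h3⟩ := h
  simp only [outLabel, inLabel, outVec, inVec, next, prev, here] at *
  split_ifs at h1 h2 h3 with h4 h5 h5
  · left
    simp only [Option.some.injEq, Prod.mk.injEq, Subtype.mk.injEq, true_and] at h3
    obtain ⟨rfl, rfl⟩ := h3
    have h6 : k' - 1 + 1 = k' := by omega
    rw [h6] at h1 ⊢
    exact ⟨rfl, h1.symm⟩
  · right
    have h6 : k = M.len v - 1 := by omega
    subst h5
    rw [h6, M.pos_last, add_sub_cancel_left] at h1
    rw [M.pos_zero, sub_add_cancel_left] at h2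
    have h7 : M.inD v' = -M.outD v := by rw [h1, ← h2, neg_neg]
    refine ⟨by omega, rfl, h7, ?_⟩
    rw [h6, M.pos_last, M.pos_zero, h7, sub_add_eq_add_sub,
      add_comm (M.st _), ← M.port _ (M.outD_mem v), ← h1, add_sub_cancel_left]

theorem step_link {v : V} {k : ℕ} (hk : k + 1 < M.len v) :
    M.Step ⟨(v, k), by simp; omega⟩ (M.pos v (k + 1) - M.pos v k) ⟨(v, k + 1), hk⟩ := by
  refine ⟨?_, ?_, ?_⟩
  · simp [outVec, next, here, hk]
  · simp [inVec, prev, here]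
  · simp [outLabel, inLabel, hk]

theorem step_port {v v' : V} (h : M.inD v' = -M.outD v) {k : ℕ} (hk : k + 1 = M.len v) :
    M.Step ⟨(v, k), by simp; omega⟩
      (M.pos v' 0 - M.pos v k + sc M.s (M.outD v))
      ⟨(v', 0), (Nat.zero_lt_two.trans_le (M.two_le_len v'))⟩ := by
  have hk' : k = M.len v - 1 := by omega
  have e : M.pos v' 0 - M.pos v k + sc M.s (M.outD v) = M.outD v := by
    rw [hk', M.pos_last, M.pos_zero, h, sub_add_eq_add_sub,
      add_comm (M.st _), ← M.port _ (M.outD_mem v), add_sub_cancel_left]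
  rw [e]
  refine ⟨?_, ?_, ?_⟩
  · simp [outVec, next, here, hk', M.pos_last, show M.len v - 1 + 1 = M.len v by omega]
  · simp [inVec, prev, here, M.pos_zero, h]
  · simp [outLabel, inLabel, hk]

variable (M)

/-- The path `(I, P)` runs through the tiling `r` along its links. -/
structure Fwd (r : Pos → Option (Tile M.Glue Nvn)) (I : Set ℤ) (P : ℤ → Pos) : Prop where
  interval : IsInterval I
  inj : ∀ i ∈ I, ∀ j ∈ I, P i = P j → i = j
  dom : tdom r = P '' I
  state : ∀ i ∈ I, ∃ q, r (P i) = some (M.tile q)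
  step : ∀ i, i ∈ I → i + 1 ∈ I → ∃ a b, r (P i) = some (M.tile a) ∧
    r (P (i + 1)) = some (M.tile b) ∧ M.Step a (P (i + 1) - P i) b

/-- The path `(I, P)` is not a cycle cut inside a cell. -/
def Unsplit (r : Pos → Option (Tile M.Glue Nvn)) (I : Set ℤ) (P : ℤ → Pos) : Prop :=
  ∀ a b x y, IsLeast I a → IsGreatest I b → r (P a) = some (M.tile x) →
    r (P b) = some (M.tile y) → M.Step y (P a - P b) x → x.1.2 = 0

variable {M}
variable {r : Pos → Option (Tile M.Glue Nvn)} {I : Set ℤ} {P : ℤ → Pos}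

theorem tile_unique {p : Pos} {a b : M.State} (ha : r p = some (M.tile a))
    (hb : r p = some (M.tile b)) : a = b :=
  tile_injective (Option.some_injective _ (ha.symm.trans hb))

theorem Fwd.step' (h : M.Fwd r I P) {i : ℤ} (hi : i ∈ I) (hi1 : i + 1 ∈ I) {a b : M.State}
    (ha : r (P i) = some (M.tile a)) (hb : r (P (i + 1)) = some (M.tile b)) :
    M.Step a (P (i + 1) - P i) b := by
  obtain ⟨a', b', ha', hb', hs⟩ := h.step i hi hi1
  rwa [tile_unique ha ha', tile_unique hb hb']

theorem Fwd.isRibbon (h : M.Fwd r I P) : IsRibbon M.tiles I P r := by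
  refine ⟨⟨⟨h.interval, ?_⟩, h.dom, ?_⟩, h.inj, ?_⟩
  · intro i hi hi1
    obtain ⟨a, b, -, -, hs⟩ := h.step i hi hi1
    rw [← hs.1]; exact outVec_mem _ _
  · intro p t hp
    have : p ∈ tdom r := by simp [tdom, hp]
    rw [h.dom] at this
    obtain ⟨i, hi, rfl⟩ := this
    obtain ⟨q, hq⟩ := h.state i hi
    rw [hp, Option.some_inj] at hq
    exact ⟨q, hq.symm⟩
  · intro i hi hi1 t t' ht ht' hv hv'
    obtain ⟨a, b, ha, hb, hs⟩ := h.step i hi hi1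
    rw [ht, Option.some_inj] at ha
    rw [ht', Option.some_inj] at hb
    subst ha hb
    exact hs.glue hv hv'

/-- Every ribbon is run through along its links by its path or by the reversed path. -/
theorem exists_fwd (h : IsRibbon M.tiles I P r) : ∃ I' P', M.Fwd r I' P' := by
  obtain ⟨⟨⟨hI, hadj⟩, hdom, ht⟩, hinj, hglue⟩ := h
  have hst : ∀ i ∈ I, ∃ q, r (P i) = some (M.tile q) := by
    intro i hi
    have : P i ∈ tdom r := hdom ▸ ⟨i, hi, rfl⟩
    obtain ⟨t, htt⟩ := Option.ne_none_iff_exists'.mp this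
    obtain ⟨q, rfl⟩ := ht _ _ htt
    exact ⟨q, htt⟩
  let F : ℤ → Prop := fun i => ∃ a b, r (P i) = some (M.tile a) ∧
    r (P (i + 1)) = some (M.tile b) ∧ M.Step a (P (i + 1) - P i) b
  let B : ℤ → Prop := fun i => ∃ a b, r (P i) = some (M.tile a) ∧
    r (P (i + 1)) = some (M.tile b) ∧ M.Step b (-(P (i + 1) - P i)) a
  have hFB : ∀ i, i ∈ I → i + 1 ∈ I → F i ∨ B i := by
    intro i hi hi1
    obtain ⟨a, ha⟩ := hst i hi
    obtain ⟨b, hb⟩ := hst _ hi1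
    rcases step_of_glue (hadj i hi hi1) (neg_mem_Nvn (hadj i hi hi1))
      (hglue i hi hi1 _ _ ha hb _ _) with h | h
    · exact Or.inl ⟨a, b, ha, hb, h⟩
    · exact Or.inr ⟨a, b, ha, hb, h⟩
  by_cases hF : ∃ i, i ∈ I ∧ i + 1 ∈ I ∧ F i
  · obtain ⟨i₀, hi₀, hi₀', h₀⟩ := hF
    have hI1 : IsInterval {i | i ∈ I ∧ i + 1 ∈ I} := fun a b c ha hc hab hbc =>
      ⟨hI a b c ha.1 hc.1 hab hbc, hI (a + 1) (b + 1) (c + 1) ha.2 hc.2 (by omega) (by omega)⟩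
    have key := hI1.induction (p := F) ⟨hi₀, hi₀'⟩ h₀ ?_ ?_
    · exact ⟨I, P, hI, hinj, hdom, hst, fun i hi hi1 => key i ⟨hi, hi1⟩⟩
    · rintro i ⟨hi, hi1⟩ ⟨-, hi2⟩ ⟨a, b, ha, hb, hs⟩
      refine (hFB _ hi1 hi2).resolve_right ?_
      rintro ⟨b', c, hb', hc, hs'⟩
      obtain rfl := tile_unique hb hb'
      have e := hs.2.1.symm.trans hs'.2.1
      have := hinj i hi _ hi2 (by simpa using e)
      omega
    · rintro i ⟨hi, hi1⟩ ⟨-, hi2⟩ ⟨b, c, hb, hc, hs⟩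
      refine (hFB _ hi hi1).resolve_right ?_
      rintro ⟨a, b', ha, hb', hs'⟩
      obtain rfl := tile_unique hb hb'
      have e := hs.1.symm.trans hs'.1
      have := hinj i hi _ hi2 (by simpa using e.symm)
      omega
  · push Not at hF
    refine ⟨{i | -i ∈ I}, fun i => P (-i), ?_, ?_, ?_, fun i hi => hst _ hi, ?_⟩
    · intro a b c ha hc hab hbc
      exact hI (-c) (-b) (-a) hc ha (by omega) (by omega)
    · intro i hi j hj h
      have := hinj _ hi _ hj h
      omega
    · rw [hdom]
      ext p
      constructor
      · rintro ⟨i, hi, rfl⟩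
        exact ⟨-i, by simpa using hi, by simp⟩
      · rintro ⟨i, hi, rfl⟩
        exact ⟨-i, hi, rfl⟩
    · intro i hi hi1
      have e : -(i + 1) + 1 = -i := by ring
      have hi' : -(i + 1) + 1 ∈ I := by rw [e]; exact hi
      obtain ⟨a, b, ha, hb, hs⟩ := (hFB _ hi1 hi').resolve_left (hF _ hi1 hi')
      rw [e] at hb hs
      exact ⟨b, a, hb, ha, by simpa using hs⟩

theorem exists_fwd_unsplit (h : IsRibbon M.tiles I P r) :
    ∃ I' P', M.Fwd r I' P' ∧ M.Unsplit r I' P' := by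
  obtain ⟨I, P, hF⟩ := exists_fwd h
  by_cases hU : M.Unsplit r I P
  · exact ⟨I, P, hF, hU⟩
  have main : ∀ n I P a b x y, M.Fwd r I P → IsLeast I a → IsGreatest I b →
      r (P a) = some (M.tile x) → r (P b) = some (M.tile y) →
      M.Step y (P a - P b) x → M.len x.1.1 - x.1.2 ≤ n →
      ∃ I' P', M.Fwd r I' P' ∧ M.Unsplit r I' P' := by
    intro n
    induction n with
    | zero =>
      intro I P a b x y _ _ _ _ _ _ hn
      have := x.2
      omega
    | succ n ih =>
      intro I P a b x y hF ha hb hx hy hs hn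
      by_cases hx0 : x.1.2 = 0
      · refine ⟨I, P, hF, fun a' b' x' y' ha' hb' hx' hy' _ => ?_⟩
        obtain rfl := ha.unique ha'
        rwa [← tile_unique hx hx']
      have hab : a < b := by
        refine lt_of_le_of_ne (ha.2 hb.1) ?_
        rintro rfl
        have := outVec_mem M y
        rw [hs.1, sub_self, mem_Nvn_iff] at this
        simp [Prod.ext_iff] at this
      have ha1 : a + 1 ∈ I := hF.interval a _ b ha.1 hb.1 (by omega) (by omega)
      obtain ⟨x₀, z, hx₀, hz, hsz⟩ := hF.step a ha.1 ha1
      obtain rfl := tile_unique hx hx₀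
      have hI : ∀ i, i ∈ I ↔ a ≤ i ∧ i ≤ b := fun i =>
        ⟨fun hi => ⟨ha.2 hi, hb.2 hi⟩, fun hi => hF.interval a i b ha.1 hb.1 hi.1 hi.2⟩
      let P' : ℤ → Pos := Function.update P (b + 1) (P a)
      have hP1 : P' (b + 1) = P a := by simp [P']
      have hP2 : ∀ i, i ≠ b + 1 → P' i = P i := fun i hi => by simp [P', hi]
      have hF' : M.Fwd r (Set.Icc (a + 1) (b + 1)) P' := by
        refine ⟨?_, ?_, ?_, ?_, ?_⟩
        · intro i j k hi hk hij hjk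
          exact ⟨hi.1.trans hij, hjk.trans hk.2⟩
        · intro i hi j hj hij
          rw [Set.mem_Icc] at hi hj
          by_cases h1 : i = b + 1 <;> by_cases h2 : j = b + 1
          · omega
          · rw [h1, hP1, hP2 j h2] at hij
            have := hF.inj a ha.1 j ((hI j).2 (by omega)) hij
            omega
          · rw [h2, hP1, hP2 i h1] at hij
            have := hF.inj i ((hI i).2 (by omega)) a ha.1 hij
            omega
          · rw [hP2 i h1, hP2 j h2] at hij
            exact hF.inj i ((hI i).2 (by omega)) j ((hI j).2 (by omega)) hij
        · rw [hF.dom]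
          ext p
          constructor
          · rintro ⟨i, hi, rfl⟩
            rw [hI] at hi
            by_cases h1 : i = a
            · exact ⟨b + 1, by simp; omega, by rw [hP1, h1]⟩
            · exact ⟨i, by simp; omega, hP2 i (by omega)⟩
          · rintro ⟨i, hi, rfl⟩
            rw [Set.mem_Icc] at hi
            by_cases h1 : i = b + 1
            · exact ⟨a, ha.1, by rw [h1, hP1]⟩
            · exact ⟨i, (hI i).2 (by omega), (hP2 i h1).symm⟩
        · intro i hi
          rw [Set.mem_Icc] at hi
          by_cases h1 : i = b + 1
          · exact ⟨x, by rw [h1, hP1, hx]⟩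
          · rw [hP2 i h1]
            exact hF.state i ((hI i).2 (by omega))
        · intro i hi hi1
          rw [Set.mem_Icc] at hi hi1
          rw [hP2 i (by omega)]
          by_cases h1 : i = b
          · subst h1
            rw [hP1]
            exact ⟨y, x, hy, hx, hs⟩
          · rw [hP2 (i + 1) (by omega)]
            exact hF.step i ((hI i).2 (by omega)) ((hI _).2 (by omega))
      have hl : IsLeast (Set.Icc (a + 1) (b + 1)) (a + 1) := isLeast_Icc (by omega)
      have hg : IsGreatest (Set.Icc (a + 1) (b + 1)) (b + 1) := isGreatest_Icc (by omega)
      rcases hsz.cases with ⟨e, -⟩ | ⟨-, e, -⟩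
      · refine ih _ P' (a + 1) (b + 1) z x hF' hl hg ?_ ?_ ?_ ?_
        · rw [hP2 _ (by omega), hz]
        · rw [hP1, hx]
        · rwa [hP1, hP2 _ (by omega)]
        · rw [e]
          have := x.2
          simp only
          omega
      · refine ⟨_, P', hF', fun a' b' x' y' ha' _ hx' _ _ => ?_⟩
        obtain rfl := hl.unique ha'
        rw [hP2 _ (by omega)] at hx'
        rwa [← tile_unique hz hx']
  unfold Unsplit at hU
  push Not at hU
  obtain ⟨a, b, x, y, ha, hb, hx, hy, hs, -⟩ := hU
  exact main _ I P a b x y hF ha hb hx hy hs le_rfl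

end CellPaths

namespace CellPaths

variable {V : Type} {M : CellPaths V}
variable {r : Pos → Option (Tile M.Glue Nvn)} {I : Set ℤ} {P : ℤ → Pos}

theorem len_pos (v : V) : 0 < M.len v := Nat.zero_lt_two.trans_le (M.two_le_len v)

variable (M) in
/-- The path runs through the whole path of `v` in the cell `u`, starting at index `i`. -/
def Complete (r : Pos → Option (Tile M.Glue Nvn)) (I : Set ℤ) (P : ℤ → Pos)
    (v : V) (i : ℤ) (u : Pos) : Prop :=
  ∀ (k : ℕ) (hk : k < M.len v), i + k ∈ I ∧ P (i + k) = sc M.s u + M.pos v k ∧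
    r (P (i + k)) = some (M.tile ⟨(v, k), hk⟩)

theorem Complete.head {v : V} {i : ℤ} {u : Pos} (h : M.Complete r I P v i u) :
    i ∈ I ∧ P i = sc M.s u + M.pos v 0 ∧ r (P i) = some (M.tile ⟨(v, 0), len_pos v⟩) := by
  simpa using h 0 (len_pos v)

/-- Once a path enters a cell, it follows the path of the cell as long as it exists. -/
theorem Fwd.follow (h : M.Fwd r I P) {v : V} {i : ℤ} {u : Pos} (hi : i ∈ I)
    (hP : P i = sc M.s u + M.pos v 0) (hr : r (P i) = some (M.tile ⟨(v, 0), len_pos v⟩)) :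
    ∀ (k : ℕ) (hk : k < M.len v), i + k ∈ I → P (i + k) = sc M.s u + M.pos v k ∧
      r (P (i + k)) = some (M.tile ⟨(v, k), hk⟩) := by
  intro k
  induction k with
  | zero => intro _ _; simpa using ⟨hP, hr⟩
  | succ k ih =>
    intro hk hik
    have hik' : i + k ∈ I := h.interval i _ _ hi hik (by omega) (by push_cast; omega)
    obtain ⟨h1, h2⟩ := ih (by omega) hik'
    have e : i + ((k + 1 : ℕ) : ℤ) = i + k + 1 := by push_cast; ring
    rw [e] at hik ⊢
    obtain ⟨a, b, ha, hb, hs⟩ := h.step _ hik' hik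
    obtain rfl := tile_unique h2 ha
    rcases hs.cases with ⟨e1, e2⟩ | ⟨e1, -⟩
    · have e3 : b = ⟨(v, k + 1), hk⟩ := Subtype.ext e1
      subst e3
      refine ⟨?_, hb⟩
      rw [sub_eq_iff_eq_add, h1] at e2
      rw [e2]
      simp only [here]
      abel
    · simp only at e1
      omega

theorem Complete.unique (h : M.Fwd r I P) {v v' : V} {i i' : ℤ} {u : Pos}
    (hc : M.Complete r I P v i u) (hc' : M.Complete r I P v' i' u) : v = v' ∧ i = i' := by
  obtain ⟨k, hk, hk0⟩ := M.origin v
  obtain ⟨k', hk', hk0'⟩ := M.origin v'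
  obtain ⟨h1, h2, h3⟩ := hc k hk
  obtain ⟨h1', h2', h3'⟩ := hc' k' hk'
  have e : P (i + k) = P (i' + k') := by rw [h2, h2', hk0, hk0']
  rw [← e] at h3'
  have e1 := tile_unique h3 h3'
  have e2 := h.inj _ h1 _ h1' e
  simp only [Subtype.mk.injEq, Prod.mk.injEq] at e1
  exact ⟨e1.1, by omega⟩

/-- Complete passages through cells do not overlap. -/
theorem Complete.eq_of_state {v v' : V} {i i' : ℤ} {u u' : Pos} {k k' : ℕ}
    (hc : M.Complete r I P v i u) (hc' : M.Complete r I P v' i' u')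
    (hk : k < M.len v) (hk' : k' < M.len v') (e : i + k = i' + k') :
    v = v' ∧ i = i' ∧ u = u' := by
  obtain ⟨h1, h2, h3⟩ := hc k hk
  obtain ⟨h1', h2', h3'⟩ := hc' k' hk'
  rw [← e] at h2' h3'
  have e1 := tile_unique h3 h3'
  simp only [Subtype.mk.injEq, Prod.mk.injEq] at e1
  obtain ⟨rfl, rfl⟩ := e1
  refine ⟨rfl, by omega, sc_injective M.hs (add_right_cancel (h2.symm.trans h2'))⟩

theorem Complete.le_of_lt {v v' : V} {i i' : ℤ} {u u' : Pos}
    (hc : M.Complete r I P v i u) (hc' : M.Complete r I P v' i' u') (hlt : i < i') :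
    i + M.len v ≤ i' := by
  by_contra hcon
  have := (hc.eq_of_state (k := (i' - i).toNat) (k' := 0) hc' (by omega) (len_pos v')
    (by simp; omega)).2.1
  omega

/-- Consecutive complete passages happen in adjacent cells. -/
theorem Complete.consecutive (h : M.Fwd r I P) {v v' : V} {i i' : ℤ} {u u' : Pos}
    (hc : M.Complete r I P v i u) (hc' : M.Complete r I P v' i' u') (hlt : i < i')
    (hnone : ∀ l w x, M.Complete r I P w l x → i < l → i' ≤ l) :
    i' = i + M.len v ∧ u' = u + M.outD v := by
  have hle := hc.le_of_lt hc' hlt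
  have hlen := len_pos (M := M) v
  obtain ⟨h1, h2, h3⟩ := hc (M.len v - 1) (by omega)
  have e : i + ((M.len v - 1 : ℕ) : ℤ) + 1 = i + M.len v := by omega
  have hm : i + M.len v ∈ I :=
    h.interval i _ i' hc.head.1 hc'.head.1 (by omega) hle
  obtain ⟨a, b, ha, hb, hs⟩ := h.step _ h1 (by rw [e]; exact hm)
  obtain rfl := tile_unique h3 ha
  rw [e] at hb hs
  rcases hs.cases with ⟨e1, -⟩ | ⟨-, e0, eD, e2⟩
  · have := b.2
    rw [e1] at this
    simp only at this
    omega
  obtain ⟨⟨w, k⟩, hk⟩ := b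
  simp only [here] at e0 eD e2
  subst e0
  have hP : P (i + M.len v) = sc M.s (u + M.outD v) + M.pos w 0 := by
    rw [sub_eq_iff_eq_add, h2] at e2
    rw [e2, sc_add]
    abel
  have hfol := h.follow hm hP hb
  rcases eq_or_lt_of_le hle with heq | hlt'
  · refine ⟨heq.symm, ?_⟩
    obtain ⟨-, g2, g3⟩ := hc'.head
    rw [heq] at hP hb
    have e3 := tile_unique hb g3
    simp only [Subtype.mk.injEq, Prod.mk.injEq, and_true] at e3
    subst e3
    exact sc_injective M.hs (add_right_cancel (g2.symm.trans hP))
  · exfalso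
    by_cases hcase : i + M.len v + M.len w ≤ i'
    · have : M.Complete r I P w (i + M.len v) (u + M.outD v) := fun k hk => by
        have hkI : i + M.len v + k ∈ I :=
          h.interval _ _ i' hm hc'.head.1 (by omega) (by omega)
        exact ⟨hkI, hfol k hk hkI⟩
      have := hnone _ _ _ this (by omega)
      omega
    · obtain ⟨g1, g2, g3⟩ := hc'.head
      have e4 : i + M.len v + ((i' - (i + M.len v)).toNat : ℤ) = i' := by omega
      have := (hfol (i' - (i + M.len v)).toNat (by omega) (by rw [e4]; exact g1)).2
      rw [e4] at this
      have e3 := tile_unique this g3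
      simp only [Subtype.mk.injEq, Prod.mk.injEq] at e3
      omega

/-- If all the tiles of the path of a cell are present, the path runs through the cell. -/
theorem Fwd.complete_of_sub (h : M.Fwd r I P) (hU : M.Unsplit r I P) {v : V} {u : Pos}
    (hsub : ∀ (k : ℕ) (hk : k < M.len v),
      r (sc M.s u + M.pos v k) = some (M.tile ⟨(v, k), hk⟩)) :
    ∃ i, M.Complete r I P v i u := by
  have hidx : ∀ k < M.len v, ∃ m ∈ I, P m = sc M.s u + M.pos v k := by
    intro k hk
    have : sc M.s u + M.pos v k ∈ tdom r := by simp [tdom, hsub k hk]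
    rw [h.dom] at this
    exact this
  obtain ⟨i, hi, hPi⟩ := hidx 0 (len_pos v)
  refine ⟨i, ?_⟩
  intro k
  induction k with
  | zero =>
    intro hk
    refine ⟨by simpa using hi, by simpa using hPi, ?_⟩
    have := hsub 0 hk
    rw [← hPi] at this
    simpa using this
  | succ k ih =>
    intro hk
    obtain ⟨h1, h2, h3⟩ := ih (by omega)
    obtain ⟨m, hm, hPm⟩ := hidx (k + 1) hk
    have hrm := hsub (k + 1) hk
    rw [← hPm] at hrm
    have hstep : M.Step ⟨(v, k), by simp; omega⟩ (P m - P (i + k)) ⟨(v, k + 1), hk⟩ := by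
      have := step_link hk
      rwa [hPm, h2, add_sub_add_left_eq_sub]
    have hmk : m = i + k + 1 := by
      by_cases hn : i + k + 1 ∈ I
      · obtain ⟨a, b, ha, hb, hs⟩ := h.step _ h1 hn
        obtain rfl := tile_unique h3 ha
        have e := hs.1.symm.trans hstep.1
        exact (h.inj _ hn _ hm (sub_left_injective e)).symm
      · by_cases hp : m - 1 ∈ I
        · have hs := h.step' hp (by simpa using hm) (h.state _ hp).choose_spec
            (by simpa using hrm)
          rw [sub_add_cancel] at hs
          have e := hs.2.1.symm.trans hstep.2.1
          have := h.inj _ hp _ h1 (sub_right_injective e)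
          omega
        · have hleast : IsLeast I m := ⟨hm, fun x hx => by
            by_contra hcon
            exact hp (h.interval x _ m hx hm (by omega) (by omega))⟩
          have hgreat : IsGreatest I (i + k) := ⟨h1, fun x hx => by
            by_contra hcon
            exact hn (h.interval (i + k) _ x h1 hx (by omega) (by omega))⟩
          have := hU m (i + k) _ _ hleast hgreat hrm h3 hstep
          simp at this
    have e : i + ((k + 1 : ℕ) : ℤ) = m := by push_cast; omega
    rw [e]
    exact ⟨hm, hPm, hrm⟩

variable (M) in
/-- The tiles of the path of a variant. -/
noncomputable def pieceTiles (v : V) (p : Pos) : Option (Tile M.Glue Nvn) :=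
  if h : ∃ k, ∃ _ : k < M.len v, M.pos v k = p then
    some (M.tile ⟨(v, h.choose), h.choose_spec.choose⟩) else none

theorem pieceTiles_pos (v : V) {k : ℕ} (hk : k < M.len v) :
    M.pieceTiles v (M.pos v k) = some (M.tile ⟨(v, k), hk⟩) := by
  have h : ∃ l, ∃ _ : l < M.len v, M.pos v l = M.pos v k := ⟨k, hk, rfl⟩
  have e : h.choose = k := M.pos_inj v _ _ h.choose_spec.choose hk h.choose_spec.choose_spec
  simp only [pieceTiles, dif_pos h, e]

theorem exists_of_pieceTiles {v : V} {p : Pos} (h : M.pieceTiles v p ≠ none) :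
    ∃ k < M.len v, M.pos v k = p := by
  unfold pieceTiles at h
  split_ifs at h with h'
  · obtain ⟨k, hk, e⟩ := h'
    exact ⟨k, hk, e⟩
  · exact absurd rfl h

theorem fwd_piece (v : V) (i : ℤ) :
    M.Fwd (M.pieceTiles v) (Set.Ico i (i + M.len v)) (fun m => M.pos v (m - i).toNat) := by
  refine ⟨?_, ?_, ?_, ?_, ?_⟩
  · intro a b c ha hc hab hbc
    exact ⟨ha.1.trans hab, hbc.trans_lt hc.2⟩
  · intro a ha b hb h
    rw [Set.mem_Ico] at ha hb
    have := M.pos_inj v _ _ (by omega) (by omega) h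
    omega
  · ext p
    constructor
    · intro hp
      obtain ⟨k, hk, rfl⟩ := exists_of_pieceTiles hp
      exact ⟨i + k, by simp; omega, by simp⟩
    · rintro ⟨m, hm, rfl⟩
      rw [Set.mem_Ico] at hm
      change M.pieceTiles v _ ≠ none
      rw [pieceTiles_pos v (by omega)]
      simp
  · intro m hm
    rw [Set.mem_Ico] at hm
    exact ⟨_, pieceTiles_pos v (by omega)⟩
  · intro m hm hm1
    rw [Set.mem_Ico] at hm hm1
    have e : (m + 1 - i).toNat = (m - i).toNat + 1 := by omega
    simp only [e]
    exact ⟨_, _, pieceTiles_pos v (by omega), pieceTiles_pos v (by omega),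
      step_link (by omega)⟩

variable (M) in
/-- The ribbon along the path of a variant, indexed from `i`. -/
noncomputable def piece (v : V) (i : ℤ) : Ribbon M.Glue M.tiles :=
  ⟨_, _, _, (fwd_piece v i).isRibbon⟩

variable (M) in
/-- The complete passages of a path through cells. -/
noncomputable def trim (r : Pos → Option (Tile M.Glue Nvn)) (I : Set ℤ) (P : ℤ → Pos)
    (u : Pos) : Option (Ribbon M.Glue M.tiles) :=
  if h : ∃ v i, M.Complete r I P v i u then some (M.piece h.choose h.choose_spec.choose)
  else none

theorem Complete.trim (h : M.Fwd r I P) {v : V} {i : ℤ} {u : Pos}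
    (hc : M.Complete r I P v i u) : M.trim r I P u = some (M.piece v i) := by
  have hex : ∃ v i, M.Complete r I P v i u := ⟨v, i, hc⟩
  obtain ⟨e1, e2⟩ := hc.unique h hex.choose_spec.choose_spec
  rw [CellPaths.trim, dif_pos hex]
  exact congrArg some (congrArg₂ M.piece e1.symm e2.symm)

theorem exists_of_trim {u : Pos} {S} (hS : M.trim r I P u = some S) :
    ∃ v i, M.Complete r I P v i u ∧ S = M.piece v i := by
  unfold trim at hS
  split_ifs at hS with h
  exact ⟨_, _, h.choose_spec.choose_spec, (Option.some_injective _ hS).symm⟩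

theorem Fwd.isPolyRibbon (h : M.Fwd r I P) {J : Set ℤ} {e : ℤ → ℤ} {Q : ℤ → Pos}
    (hJ : IsInterval J) (he : StrictMonoOn e J)
    (hQ : ∀ j ∈ J, ∃ v, M.Complete r I P v (e j) (Q j))
    (hall : ∀ v i u, M.Complete r I P v i u → ∃ j ∈ J, e j = i) :
    IsPolyRibbon M.s J Q (M.trim r I P) ∧
    ∀ i ∈ J, ∀ j ∈ J, i < j → ∀ S S', M.trim r I P (Q i) = some S →
      M.trim r I P (Q j) = some S' → ∀ a ∈ S.I, ∀ b ∈ S'.I, a < b := by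
  have hcons : ∀ j, j ∈ J → j + 1 ∈ J → ∀ v v', M.Complete r I P v (e j) (Q j) →
      M.Complete r I P v' (e (j + 1)) (Q (j + 1)) →
      e (j + 1) = e j + M.len v ∧ Q (j + 1) = Q j + M.outD v := by
    intro j hj hj1 v v' hc hc'
    refine hc.consecutive h hc' (he hj hj1 (by omega)) ?_
    intro l w x hw hl
    obtain ⟨m, hm, rfl⟩ := hall _ _ _ hw
    rw [he.lt_iff_lt hj hm] at hl
    rw [he.le_iff_le hj1 hm]
    omega
  have hinj : ∀ i ∈ J, ∀ j ∈ J, Q i = Q j → i = j := by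
    intro i hi j hj hij
    obtain ⟨v, hv⟩ := hQ i hi
    obtain ⟨w, hw⟩ := hQ j hj
    rw [← hij] at hw
    exact he.injOn hi hj (hv.unique h hw).2
  refine ⟨⟨⟨hJ, ?_⟩, hinj, ?_, ?_, ?_, ?_⟩, ?_⟩
  · intro j hj hj1
    obtain ⟨v, hv⟩ := hQ j hj
    obtain ⟨w, hw⟩ := hQ _ hj1
    rw [(hcons j hj hj1 v w hv hw).2, add_sub_cancel_left]
    exact M.outD_mem v
  · ext u
    constructor
    · intro hu
      obtain ⟨S, hS⟩ := Option.ne_none_iff_exists'.mp hu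
      obtain ⟨v, i, hc, -⟩ := exists_of_trim hS
      obtain ⟨j, hj, rfl⟩ := hall _ _ _ hc
      obtain ⟨w, hw⟩ := hQ j hj
      exact ⟨j, hj, (hw.eq_of_state hc (len_pos w) (len_pos v) rfl).2.2⟩
    · rintro ⟨j, hj, rfl⟩
      obtain ⟨w, hw⟩ := hQ j hj
      simp [tdom, hw.trim h]
  · intro u R hR
    obtain ⟨v, i, -, rfl⟩ := exists_of_trim hR
    refine ⟨Set.finite_Ico _ _, i, ?_⟩
    have := len_pos (M := M) v
    simp [piece, this]
  · intro u u' R S hne hR hS p hp q hq heq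
    obtain ⟨v, i, hc, rfl⟩ := exists_of_trim hR
    obtain ⟨v', i', hc', rfl⟩ := exists_of_trim hS
    obtain ⟨k, hk, rfl⟩ := exists_of_pieceTiles hp
    obtain ⟨k', hk', rfl⟩ := exists_of_pieceTiles hq
    obtain ⟨h1, h2, h3⟩ := hc k hk
    obtain ⟨h1', h2', h3'⟩ := hc' k' hk'
    rw [← h2, ← h2'] at heq
    exact hne (hc.eq_of_state hc' hk hk' (h.inj _ h1 _ h1' heq)).2.2
  · intro j hj hj1 R₁ R₂ hR₁ hR₂ m₁ hm₁ m₂ hm₂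
    obtain ⟨v, hv⟩ := hQ j hj
    obtain ⟨w, hw⟩ := hQ _ hj1
    have hlv := len_pos (M := M) v
    have hlw := len_pos (M := M) w
    obtain ⟨he1, -⟩ := hcons j hj hj1 v w hv hw
    rw [hv.trim h, Option.some_inj] at hR₁
    rw [hw.trim h, Option.some_inj] at hR₂
    subst hR₁ hR₂
    have hm₁' : m₁ = e j + ((M.len v - 1 : ℕ) : ℤ) := by
      refine hm₁.unique ⟨by simp [piece]; omega, fun x hx => ?_⟩
      simp only [piece, Set.mem_Ico] at hx
      omega
    have hm₂' : m₂ = e (j + 1) := by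
      refine hm₂.unique ⟨by simp [piece]; omega, fun x hx => ?_⟩
      simp only [piece, Set.mem_Ico] at hx
      omega
    have hP₁ : (M.piece v (e j)).P m₁ = M.pos v (M.len v - 1) := by
      simp [piece, hm₁']
    have hP₂ : (M.piece w (e (j + 1))).P m₂ = M.pos w 0 := by
      simp [piece, hm₂']
    have hr₁ : (M.piece v (e j)).r (M.pos v (M.len v - 1)) =
        some (M.tile ⟨(v, M.len v - 1), Nat.sub_lt hlv one_pos⟩) := pieceTiles_pos v _
    have hr₂ : (M.piece w (e (j + 1))).r (M.pos w 0) = some (M.tile ⟨(w, 0), hlw⟩) :=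
      pieceTiles_pos w _
    obtain ⟨g1, g2, g3⟩ := hv (M.len v - 1) (by omega)
    obtain ⟨g1', g2', g3'⟩ := hw.head
    have e1 : e j + ((M.len v - 1 : ℕ) : ℤ) + 1 = e (j + 1) := by omega
    have hs := h.step' g1 (by rw [e1]; exact g1') g3 (by rw [e1]; exact g3')
    rw [e1, g2, g2'] at hs
    rw [hP₁, hP₂]
    refine ⟨hs.1 ▸ outVec_mem M _, ?_⟩
    intro t₁ t₂ ht₁ ht₂ hv1 hv2
    rw [hr₁, Option.some_inj] at ht₁
    rw [hr₂, Option.some_inj] at ht₂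
    subst ht₁ ht₂
    exact hs.glue hv1 hv2
  · intro i hi j hj hij S S' hS hS' a ha b hb
    obtain ⟨v, hv⟩ := hQ i hi
    obtain ⟨w, hw⟩ := hQ j hj
    rw [hv.trim h, Option.some_inj] at hS
    rw [hw.trim h, Option.some_inj] at hS'
    subst hS hS'
    have := hv.le_of_lt hw (he hi hj hij)
    simp only [piece, Set.mem_Ico] at ha hb
    omega

end CellPaths

namespace CellPaths

variable {V : Type} {M : CellPaths V}

/-- Paths through the cells of a path, with matching sides and without overlap, can be
concatenated. -/
theorem exists_fwd_of_variants {I : Set ℤ} {P : ℤ → Pos} (hI : IsInterval I) (v : ℤ → V)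
    (hlink : ∀ i, i ∈ I → i + 1 ∈ I →
      P (i + 1) = P i + M.outD (v i) ∧ M.inD (v (i + 1)) = -M.outD (v i))
    (hdisj : ∀ i ∈ I, ∀ j ∈ I, i ≠ j → ∀ k < M.len (v i), ∀ l < M.len (v j),
      sc M.s (P i) + M.pos (v i) k ≠ sc M.s (P j) + M.pos (v j) l) :
    ∃ r K Q e, M.Fwd r K Q ∧ M.Unsplit r K Q ∧ StrictMonoOn e I ∧
      (∀ i ∈ I, M.Complete r K Q (v i) (e i) (P i)) ∧
      ∀ w m u, M.Complete r K Q w m u → ∃ i ∈ I, e i = m := by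
  obtain ⟨e, he⟩ := exists_primitive fun i => (M.len (v i) : ℤ)
  have hmono : StrictMono e := by
    refine strictMono_int_of_lt_succ fun i => ?_
    rw [he]
    have := len_pos (M := M) (v i)
    omega
  let r : Pos → Option (Tile M.Glue Nvn) := fun p =>
    if h : ∃ q : M.State, ∃ i ∈ I, v i = q.1.1 ∧ p = sc M.s (P i) + M.here q then
      some (M.tile h.choose) else none
  let Q : ℤ → Pos := fun m =>
    if h : ∃ i ∈ I, e i ≤ m ∧ m < e (i + 1) then
      sc M.s (P h.choose) + M.pos (v h.choose) (m - e h.choose).toNat else 0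
  have hr : ∀ i ∈ I, ∀ (k : ℕ) (hk : k < M.len (v i)),
      r (sc M.s (P i) + M.pos (v i) k) = some (M.tile ⟨(v i, k), hk⟩) := by
    intro i hi k hk
    have h : ∃ q : M.State, ∃ j ∈ I, v j = q.1.1 ∧
      sc M.s (P i) + M.pos (v i) k = sc M.s (P j) + M.here q := ⟨⟨(v i, k), hk⟩, i, hi, rfl, rfl⟩
    have hc : h.choose = ⟨(v i, k), hk⟩ := by
      obtain ⟨j, hj, h1, h2⟩ := h.choose_spec
      generalize h.choose = q at h1 h2
      obtain ⟨⟨w, l⟩, hl⟩ := q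
      simp only [here] at h1 h2 hl
      subst h1
      obtain rfl : i = j := by
        by_contra hne
        exact hdisj i hi j hj hne k hk l hl h2
      obtain rfl := M.pos_inj _ _ _ hk hl (add_left_cancel h2)
      rfl
    simp only [r, dif_pos h, hc]
  have hQ : ∀ i ∈ I, ∀ k < M.len (v i), Q (e i + k) = sc M.s (P i) + M.pos (v i) k := by
    intro i hi k hk
    have h : ∃ j ∈ I, e j ≤ e i + k ∧ e i + k < e (j + 1) :=
      ⟨i, hi, by omega, by rw [he]; omega⟩
    have hc : h.choose = i := by
      obtain ⟨-, h1, h2⟩ := h.choose_spec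
      have h3 : e i < e (h.choose + 1) := by omega
      have h4 : e h.choose < e (i + 1) := by rw [he i]; omega
      rw [hmono.lt_iff_lt] at h3 h4
      omega
    simp only [Q, dif_pos h, hc, add_sub_cancel_left, Int.toNat_natCast]
  let K : Set ℤ := {m | ∃ i ∈ I, ∃ k : ℕ, k < M.len (v i) ∧ m = e i + k}
  have hnext : ∀ i ∈ I, ∀ k < M.len (v i), ∀ j ∈ I, ∀ l < M.len (v j),
      e i + k + 1 ≤ e j + l → (k + 1 < M.len (v i)) ∨
        (k + 1 = M.len (v i) ∧ e i + k + 1 = e (i + 1) ∧ i + 1 ∈ I) := by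
    intro i hi k hk j hj l hl hle
    rcases Nat.lt_or_ge (k + 1) (M.len (v i)) with h | h
    · exact Or.inl h
    · refine Or.inr ⟨by omega, by rw [he]; omega, ?_⟩
      have h3 : e (i + 1) < e (j + 1) := by rw [he, he]; omega
      rw [hmono.lt_iff_lt] at h3
      exact hI i _ j hi hj (by omega) (by omega)
  have hK : IsInterval K := by
    intro a b c ha hc hab hbc
    have : ∀ n : ℕ, a + n ≤ c → a + n ∈ K := by
      intro n
      induction n with
      | zero => intro _; simpa using ha
      | succ n ih =>
        intro hn
        obtain ⟨i, hi, k, hk, hik⟩ := ih (by push_cast at hn; omega)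
        obtain ⟨j, hj, l, hl, rfl⟩ := hc
        rcases hnext i hi k hk j hj l hl (by push_cast at hn; omega) with h | ⟨-, h, h'⟩
        · exact ⟨i, hi, k + 1, h, by push_cast; omega⟩
        · exact ⟨i + 1, h', 0, len_pos _, by push_cast; omega⟩
    have := this (b - a).toNat (by omega)
    rwa [show a + ((b - a).toNat : ℤ) = b by omega] at this
  have hF : M.Fwd r K Q := by
    refine ⟨hK, ?_, ?_, ?_, ?_⟩
    · rintro _ ⟨i, hi, k, hk, rfl⟩ _ ⟨j, hj, l, hl, rfl⟩ h
      rw [hQ i hi k hk, hQ j hj l hl] at h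
      obtain rfl : i = j := by
        by_contra hne
        exact hdisj i hi j hj hne k hk l hl h
      rw [M.pos_inj _ _ _ hk hl (add_left_cancel h)]
    · ext p
      constructor
      · intro hp
        have : ∃ q : M.State, ∃ i ∈ I, v i = q.1.1 ∧ p = sc M.s (P i) + M.here q := by
          by_contra hcon
          exact hp (dif_neg hcon)
        obtain ⟨⟨⟨w, k⟩, hk⟩, i, hi, h1, rfl⟩ := this
        simp only at h1 hk
        subst h1
        exact ⟨e i + k, ⟨i, hi, k, hk, rfl⟩, hQ i hi k hk⟩
      · rintro ⟨_, ⟨i, hi, k, hk, rfl⟩, rfl⟩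
        rw [hQ i hi k hk]
        change r _ ≠ none
        rw [hr i hi k hk]
        simp
    · rintro _ ⟨i, hi, k, hk, rfl⟩
      rw [hQ i hi k hk]
      exact ⟨_, hr i hi k hk⟩
    · rintro _ ⟨i, hi, k, hk, rfl⟩ ⟨j, hj, l, hl, hjl⟩
      rcases hnext i hi k hk j hj l hl (by omega) with h | ⟨h0, h, h'⟩
      · have e1 : e i + k + 1 = e i + ((k + 1 : ℕ) : ℤ) := by push_cast; ring
        rw [e1, hQ i hi k hk, hQ i hi _ h, add_sub_add_left_eq_sub]
        exact ⟨_, _, hr i hi k hk, hr i hi _ h, step_link h⟩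
      · have h1 := hQ _ h' 0 (len_pos _)
        rw [Nat.cast_zero, add_zero] at h1
        obtain ⟨h2, h3⟩ := hlink i hi h'
        rw [h, h1, hQ i hi k hk]
        refine ⟨_, _, hr i hi k hk, hr _ h' 0 (len_pos _), ?_⟩
        have := step_port h3 h0
        rw [h2, sc_add]
        convert this using 1
        abel
  have hC : ∀ i ∈ I, M.Complete r K Q (v i) (e i) (P i) := by
    intro i hi k hk
    refine ⟨⟨i, hi, k, hk, rfl⟩, hQ i hi k hk, ?_⟩
    rw [hQ i hi k hk]
    exact hr i hi k hk
  refine ⟨r, K, Q, e, hF, ?_, fun i _ j _ h => hmono h, hC, ?_⟩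
  · rintro a b x y ⟨⟨i, hi, k, hk, rfl⟩, ha⟩ - hx - -
    have := ha ((hC i hi).head.1)
    obtain rfl : k = 0 := by omega
    rw [hQ i hi 0 hk, hr i hi 0 hk, Option.some_inj] at hx
    rw [← tile_injective hx]
  · intro w m u hw
    obtain ⟨⟨i, hi, k, hk, rfl⟩, h2, h3⟩ := hw.head
    rw [hQ i hi k hk, hr i hi k hk, Option.some_inj] at h3
    have := tile_injective h3
    simp only [Subtype.mk.injEq, Prod.mk.injEq] at this
    refine ⟨i, hi, ?_⟩
    rw [this.2]
    simp

theorem order_exists (R : Ribbon M.Glue M.tiles) :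
    ∃ IP : Set ℤ × (ℤ → Pos), (M.Fwd R.r IP.1 IP.2 ∧ M.Unsplit R.r IP.1 IP.2) ∧
      (M.Fwd R.r R.I R.P ∧ M.Unsplit R.r R.I R.P → IP = (R.I, R.P)) := by
  by_cases h : M.Fwd R.r R.I R.P ∧ M.Unsplit R.r R.I R.P
  · exact ⟨(R.I, R.P), h, fun _ => rfl⟩
  · obtain ⟨I, P, hIP⟩ := exists_fwd_unsplit R.isRibbon
    exact ⟨(I, P), hIP, fun h' => absurd h' h⟩

variable (M) in
/-- The complete passages of a ribbon through cells. -/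
noncomputable def chi (R : Ribbon M.Glue M.tiles) : Pos → Option (Ribbon M.Glue M.tiles) :=
  M.trim R.r (order_exists R).choose.1 (order_exists R).choose.2

variable (M) in
/-- The assignment of paths to tiles, given the tile represented by each variant. -/
def assignment {α : Type} (ty : V → α) (t : α) : Set (Ribbon M.Glue M.tiles) :=
  {S | ∃ v i, ty v = t ∧ S = M.piece v i}

theorem piece_r_injective {v w : V} {i j : ℤ} {p q : Pos} {a : Tile M.Glue Nvn}
    (h : (M.piece v i).r p = some a) (h' : (M.piece w j).r q = some a) : v = w := by
  obtain ⟨k, hk, rfl⟩ := exists_of_pieceTiles (by rw [show M.pieceTiles v p = _ from h]; simp)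
  obtain ⟨l, hl, rfl⟩ := exists_of_pieceTiles (by rw [show M.pieceTiles w q = _ from h']; simp)
  have h1 : some (M.tile ⟨(v, k), hk⟩) = some a := (pieceTiles_pos v hk).symm.trans h
  have h2 : some (M.tile ⟨(w, l), hl⟩) = some a := (pieceTiles_pos w hl).symm.trans h'
  have := tile_injective (Option.some_injective _ (h1.trans h2.symm))
  simp only [Subtype.mk.injEq, Prod.mk.injEq] at this
  exact this.1

theorem assignment_specific {α : Type} {ty : V → α} {t t' : α} {S S' : Ribbon M.Glue M.tiles}
    (hS : S ∈ M.assignment ty t) (hS' : S' ∈ M.assignment ty t') {p q : Pos}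
    {a : Tile M.Glue Nvn} (h : S.r p = some a) (h' : S'.r q = some a) : t = t' := by
  obtain ⟨v, i, rfl, rfl⟩ := hS
  obtain ⟨w, j, rfl, rfl⟩ := hS'
  rw [piece_r_injective h h']

variable (M) in
/-- The simulations of a zipper. -/
def simulations {α : Type} (ty : V → α) (I : Set ℤ) (P : ℤ → Pos) (r : Pos → Option α) :
    Set (Pos → Option (Ribbon M.Glue M.tiles)) :=
  {ρ | IsPolyRibbon M.s I P ρ ∧
    (∀ u t, r u = some t → ∀ S, ρ u = some S → S ∈ M.assignment ty t) ∧
    ∀ i ∈ I, ∀ j ∈ I, i < j → ∀ S S', ρ (P i) = some S → ρ (P j) = some S' →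
      ∀ a ∈ S.I, ∀ b ∈ S'.I, a < b}

theorem simulations_unique {X : Type} {N : Set Pos} {T : Set (Tile X N)} {ty : V → Tile X N}
    {I I' : Set ℤ} {P P' : ℤ → Pos} {r r' : Pos → Option (Tile X N)} {ρ}
    (hz : IsZipper T I P r) (hz' : IsZipper T I' P' r')
    (h : ρ ∈ M.simulations ty I P r) (h' : ρ ∈ M.simulations ty I' P' r') :
    r = r' ∧ ∃ d : ℤ, (∀ i, i ∈ I ↔ i + d ∈ I') ∧ ∀ i ∈ I, P' (i + d) = P i := by
  obtain ⟨⟨⟨⟨hI, -⟩, hdom, -⟩, hinj, -⟩, ⟨⟨⟨hI', -⟩, hdom', -⟩, hinj', -⟩⟩ := And.intro hz hz'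
  obtain ⟨⟨⟨-, -, hρ, hρf, -⟩, hty, hord⟩, ⟨⟨-, -, hρ', -⟩, hty', hord'⟩⟩ := And.intro h h'
  have hPP : P '' I = P' '' I' := hρ.symm.trans hρ'
  have hS : ∀ i ∈ I, ∃ S, ρ (P i) = some S := fun i hi => by
    have : P i ∈ tdom ρ := hρ ▸ ⟨i, hi, rfl⟩
    exact Option.ne_none_iff_exists'.mp this
  constructor
  · funext u
    have hu : u ∈ tdom r ↔ u ∈ tdom r' := by rw [hdom, hdom', hPP]
    cases hru : r u with
    | none =>
      have : u ∉ tdom r := fun hh => hh hru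
      rw [hu] at this
      exact (not_not.mp this).symm
    | some t =>
      have h1 : u ∈ tdom r := by simp [tdom, hru]
      obtain ⟨t', ht'⟩ := Option.ne_none_iff_exists'.mp (hu.1 h1)
      rw [hdom] at h1
      obtain ⟨i, hi, rfl⟩ := h1
      obtain ⟨S, hSi⟩ := hS i hi
      have m1 := hty _ _ hru S hSi
      have m2 := hty' _ _ ht' S hSi
      obtain ⟨v, j, e1, rfl⟩ := m1
      have hp : (M.piece v j).r (M.pos v 0) = _ := pieceTiles_pos v (len_pos v)
      rw [ht', assignment_specific ⟨v, j, e1, rfl⟩ m2 hp hp]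
  · have hg : ∀ i, ∃ j, i ∈ I → j ∈ I' ∧ P' j = P i := fun i => by
      by_cases hi : i ∈ I
      · have : P i ∈ P' '' I' := hPP ▸ ⟨i, hi, rfl⟩
        obtain ⟨j, hj, e⟩ := this
        exact ⟨j, fun _ => ⟨hj, e⟩⟩
      · exact ⟨0, fun h => absurd h hi⟩
    choose g hg using hg
    have hgmono : ∀ i ∈ I, ∀ j ∈ I, i < j → g i < g j := by
      intro i hi j hj hij
      obtain ⟨S, hSi⟩ := hS i hi
      obtain ⟨S', hSj⟩ := hS j hj
      obtain ⟨-, a, ha⟩ := hρf _ _ hSi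
      obtain ⟨-, b, hb⟩ := hρf _ _ hSj
      have h1 := hord i hi j hj hij S S' hSi hSj a ha b hb
      by_contra hcon
      rcases eq_or_lt_of_le (not_lt.mp hcon) with he | hlt
      · have := hinj i hi j hj (by rw [← (hg i hi).2, ← (hg j hj).2, he])
        omega
      · have := hord' _ (hg j hj).1 _ (hg i hi).1 hlt S' S (by rw [(hg j hj).2, hSj])
          (by rw [(hg i hi).2, hSi]) b hb a ha
        omega
    obtain ⟨d, hd, hgd⟩ := exists_shift hI g (fun i hi => (hg i hi).1) hgmono hI' (by
      intro j hj
      have : P' j ∈ P '' I := hPP ▸ ⟨j, hj, rfl⟩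
      obtain ⟨i, hi, e⟩ := this
      exact ⟨i, hi, hinj' _ (hg i hi).1 _ hj (by rw [(hg i hi).2, e])⟩)
    exact ⟨d, hd, fun i hi => by rw [← hgd i hi]; exact (hg i hi).2⟩

/-- CellPaths-cells simulate a tile system as soon as overlaps detect all mismatches between
the tiles they represent, and zippers can be represented without overlap. -/
theorem exists_zipperSimulation {X : Type} {N : Set Pos} {T : Set (Tile X N)}
    (ty : V → Tile X N) (hty : ∀ v, ty v ∈ T)
    (hmeet : ∀ (w : Pos) (hw : w ∈ N) (hw' : -w ∈ N) (v v' : V),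
      (∀ k < M.len v, ∀ l < M.len v', M.pos v k ≠ sc M.s w + M.pos v' l) →
      ty v ⟨w, hw⟩ = ty v' ⟨-w, hw'⟩)
    (h0 : (0, 0) ∉ N)
    (hreal : ∀ I P r, IsZipper T I P r → I.Nonempty → ∃ v : ℤ → V,
      (∀ i ∈ I, r (P i) = some (ty (v i))) ∧
      (∀ i, i ∈ I → i + 1 ∈ I →
        P (i + 1) = P i + M.outD (v i) ∧ M.inD (v (i + 1)) = -M.outD (v i)) ∧
      ∀ i ∈ I, ∀ j ∈ I, i ≠ j → ∀ k < M.len (v i), ∀ l < M.len (v j),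
        sc M.s (P i) + M.pos (v i) k ≠ sc M.s (P j) + M.pos (v j) l) :
    ∃ sim : ZipperSimulation X M.Glue N T M.tiles M.s,
      ∀ I P r, IsZipper T I P r →
        ∃ R : Ribbon M.Glue M.tiles, sim.chi R ∈ sim.psi I P r := by
  have hspec := fun R : Ribbon M.Glue M.tiles => (order_exists R).choose_spec
  have hmain : ∀ I P r, IsZipper T I P r →
      ∃ R : Ribbon M.Glue M.tiles, M.chi R ∈ M.simulations ty I P r := by
    intro I P r hz
    have hdata : ∃ r' K Q e, M.Fwd r' K Q ∧ M.Unsplit r' K Q ∧ StrictMonoOn e I ∧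
        (∀ i ∈ I, ∃ v, M.Complete r' K Q v (e i) (P i) ∧ r (P i) = some (ty v)) ∧
        ∀ w m u, M.Complete r' K Q w m u → ∃ i ∈ I, e i = m := by
      rcases I.eq_empty_or_nonempty with rfl | hI
      · refine ⟨fun _ => none, ∅, P, id, ⟨?_, ?_, ?_, ?_, ?_⟩, ?_, ?_, ?_, ?_⟩
        · exact fun a b c h => h.elim
        · exact fun i h => h.elim
        · simp [tdom]
        · exact fun i h => h.elim
        · exact fun i h => h.elim
        · exact fun a b x y h => h.1.elim
        · exact fun i h => h.elim
        · exact fun i h => h.elim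
        · exact fun w m u h => h.head.1.elim
      · obtain ⟨v, h1, h2, h3⟩ := hreal I P r hz hI
        obtain ⟨r', K, Q, e, a1, a2, a3, a4, a5⟩ :=
          exists_fwd_of_variants hz.1.1.1 v h2 h3
        exact ⟨r', K, Q, e, a1, a2, a3, fun i hi => ⟨v i, a4 i hi, h1 i hi⟩, a5⟩
    obtain ⟨r', K, Q, e, hF, hU, he, hC, hall⟩ := hdata
    refine ⟨⟨K, Q, r', hF.isRibbon⟩, ?_⟩
    have ho : M.chi ⟨K, Q, r', hF.isRibbon⟩ = M.trim r' K Q := by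
      unfold chi
      rw [(hspec ⟨K, Q, r', hF.isRibbon⟩).2 ⟨hF, hU⟩]
    rw [ho]
    obtain ⟨p1, p2⟩ := hF.isPolyRibbon hz.1.1.1 he
      (fun i hi => ⟨_, (hC i hi).choose_spec.1⟩) hall
    refine ⟨p1, ?_, p2⟩
    intro u t hu S hS
    have : u ∈ tdom r := by simp [tdom, hu]
    rw [hz.1.2.1] at this
    obtain ⟨i, hi, rfl⟩ := this
    obtain ⟨v, hv, hv'⟩ := hC i hi
    rw [hv.trim hF, Option.some_inj] at hS
    rw [hu, Option.some_inj] at hv'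
    exact ⟨v, e i, hv'.symm, hS.symm⟩
  have hex : ∀ R : Ribbon M.Glue M.tiles,
      ∃ I P r, IsZipper T I P r ∧ M.chi R ∈ M.simulations ty I P r := by
    intro R
    obtain ⟨⟨hF, -⟩, -⟩ := hspec R
    have hchi : M.chi R = M.trim R.r (order_exists R).choose.1 (order_exists R).choose.2 := rfl
    generalize (order_exists R).choose = IP at hF hchi
    obtain ⟨K, Q⟩ := IP
    obtain ⟨J, e, hJ, he, heJ⟩ :=
      exists_enumeration {i | ∃ v u, M.Complete R.r K Q v i u}
    have hc : ∀ j, ∃ u, j ∈ J → ∃ v, M.Complete R.r K Q v (e j) u := by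
      intro j
      by_cases hj : j ∈ J
      · have : e j ∈ {i | ∃ v u, M.Complete R.r K Q v i u} := heJ ▸ ⟨j, hj, rfl⟩
        obtain ⟨v, u, h⟩ := this
        exact ⟨u, fun _ => ⟨v, h⟩⟩
      · exact ⟨0, fun h => absurd h hj⟩
    choose Q' hQ' using hc
    obtain ⟨p1, p2⟩ := hF.isPolyRibbon hJ he hQ' (fun v i u h => by
      have : i ∈ e '' J := heJ ▸ ⟨v, u, h⟩
      exact this)
    let r : Pos → Option (Tile X N) := fun u =>
      if h : ∃ v i, M.Complete R.r K Q v i u then some (ty h.choose) else none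
    have hr : ∀ u t, r u = some t → ∃ v i, M.Complete R.r K Q v i u ∧ t = ty v := by
      intro u t hu
      simp only [r] at hu
      split_ifs at hu with h
      exact ⟨_, _, h.choose_spec.choose_spec, (Option.some_injective _ hu).symm⟩
    have hdom : tdom r = tdom (M.trim R.r K Q) := by
      ext u
      by_cases h : ∃ v i, M.Complete R.r K Q v i u
      · simp [tdom, r, trim, h]
      · simp [tdom, r, trim, h]
    refine ⟨J, Q', r, ⟨⟨p1.1, hdom.trans p1.2.2.1, ?_⟩, p1.2.1, ?_, ?_⟩, ?_⟩
    · intro u t hu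
      obtain ⟨v, -, -, rfl⟩ := hr u t hu
      exact hty v
    · intro u t hu
      obtain ⟨v, -, -, rfl⟩ := hr u t hu
      exact hty v
    · intro u t hu w t' hu' hw hw'
      obtain ⟨v, i, hv, rfl⟩ := hr _ _ hu
      obtain ⟨v', i', hv', rfl⟩ := hr _ _ hu'
      refine hmeet w hw hw' v v' fun k hk l hl heq => ?_
      obtain ⟨g1, g2, -⟩ := hv k hk
      obtain ⟨g1', g2', -⟩ := hv' l hl
      have heq' : Q (i + k) = Q (i' + l) := by
        rw [g2, g2', heq, sc_add, add_assoc]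
      have := (hv.eq_of_state hv' hk hl (hF.inj _ g1 _ g1' heq')).2.2
      rw [left_eq_add] at this
      exact h0 (by rwa [this] at hw)
    · rw [hchi]
      refine ⟨p1, ?_, p2⟩
      intro u t hu S hS
      obtain ⟨v, i, hv, rfl⟩ := hr u t hu
      rw [hv.trim hF, Option.some_inj] at hS
      exact ⟨v, i, rfl, hS.symm⟩
  refine ⟨⟨M.hs, M.assignment ty, ?_, ?_, fun t t' hne R hR S hS p q a b hp hq hab => ?_,
    M.chi, fun R => ?_, ?_, ?_, M.simulations ty,
    fun I P r hz => ?_, fun I P r _ ρ hρ => hρ.1, fun I P r _ ρ hρ => hρ.2.1, hex,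
    fun R I P r I' P' r' hz hz' h h' => simulations_unique hz hz' h h'⟩, hmain⟩
  · rintro t _ ⟨v, i, -, rfl⟩
    refine ⟨Set.finite_Ico _ _, i, ?_⟩
    have := len_pos (M := M) v
    simp [piece, this]
  · rintro t _ ⟨v, i, -, rfl⟩
    obtain ⟨k, hk, h⟩ := M.origin v
    have h1 : (M.piece v i).r (M.pos v k) = _ := pieceTiles_pos v hk
    rw [h] at h1
    exact ne_of_eq_of_ne h1 (Option.some_ne_none _)
  · subst hab
    exact hne (assignment_specific hR hS hp hq)
  · obtain ⟨I, P, r, -, h⟩ := hex R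
    exact ⟨I, P, h.1⟩
  · intro R u S hS
    obtain ⟨v, i, hv, rfl⟩ := exists_of_trim hS
    refine ⟨⟨ty v, hty v, v, i, rfl, rfl⟩, fun p a hp => ?_⟩
    obtain ⟨k, hk, rfl⟩ := exists_of_pieceTiles
      (by rw [show M.pieceTiles v p = _ from hp]; simp)
    obtain ⟨-, h2, h3⟩ := hv k hk
    rw [← h2, h3]
    exact (pieceTiles_pos v hk).symm.trans hp
  · rintro R t ht _ ⟨v, i, -, rfl⟩ u hsub
    obtain ⟨⟨hF, hU⟩, -⟩ := hspec R
    obtain ⟨j, hj⟩ := hF.complete_of_sub hU (v := v) (u := u)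
      fun k hk => hsub _ _ (pieceTiles_pos v hk)
    have := hj.trim hF
    rw [show M.chi R u = _ from this]
    simp
  · obtain ⟨R, hR⟩ := hmain I P r hz
    exact ⟨_, hR⟩

end CellPaths

/-- The pairs of consecutive elements of a list. -/
def edges {α : Type} : List α → List (α × α)
  | a :: b :: l => (a, b) :: edges (b :: l)
  | _ => []

theorem edges_append {α : Type} (A B : List α) (p : α) :
    edges (A ++ p :: B) = edges (A ++ [p]) ++ edges (p :: B) := by
  induction A with
  | nil => simp [edges]
  | cons a A ih =>
    cases A with
    | nil => simp [edges]
    | cons b A => simpa [edges] using ih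

theorem exists_of_mem_edges {α : Type} {L : List α} {p q : α} (h : (p, q) ∈ edges L) :
    ∃ A B, L = A ++ p :: q :: B := by
  induction L with
  | nil => simp [edges] at h
  | cons a L ih =>
    cases L with
    | nil => simp [edges] at h
    | cons b L =>
      simp only [edges, List.mem_cons, Prod.mk.injEq] at h
      rcases h with ⟨rfl, rfl⟩ | h
      · exact ⟨[], L, rfl⟩
      · obtain ⟨A, B, e⟩ := ih h
        exact ⟨a :: A, B, by rw [e]; rfl⟩

theorem mem_edges_reverse {α : Type} {L : List α} {p q : α} (h : (p, q) ∈ edges L) :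
    (q, p) ∈ edges L.reverse := by
  obtain ⟨A, B, rfl⟩ := exists_of_mem_edges h
  have : (A ++ p :: q :: B).reverse = B.reverse ++ q :: p :: A.reverse := by simp
  rw [this, edges_append]
  simp [edges]

/-- Self-avoiding paths in the plane. -/
structure SelfAvoiding (L : List Pos) : Prop where
  nodup : L.Nodup
  adj : ∀ e ∈ edges L, e.2 - e.1 ∈ Nvn

theorem SelfAvoiding.reverse {L : List Pos} (h : SelfAvoiding L) : SelfAvoiding L.reverse := by
  refine ⟨List.nodup_reverse.2 h.nodup, ?_⟩
  rintro ⟨p, q⟩ hpq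
  have := mem_edges_reverse hpq
  rw [List.reverse_reverse] at this
  rw [← neg_sub]
  exact neg_mem_Nvn (h.adj _ this)

theorem SelfAvoiding.append_one {L : List Pos} (h : SelfAvoiding L) {p q : Pos}
    (hp : L.getLast? = some p) (hq : q ∉ L) (hpq : q - p ∈ Nvn) :
    SelfAvoiding (L ++ [q]) ∧ ∀ e ∈ edges L, e ∈ edges (L ++ [q]) := by
  obtain ⟨A, rfl⟩ := List.getLast?_eq_some_iff.1 hp
  have he : edges (A ++ [p] ++ [q]) = edges (A ++ [p]) ++ [(p, q)] := by
    rw [List.append_assoc, List.singleton_append, edges_append]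
    rfl
  refine ⟨⟨?_, ?_⟩, ?_⟩
  · rw [List.nodup_append]
    refine ⟨h.nodup, by simp, ?_⟩
    rintro a ha b hb rfl
    rw [List.mem_singleton] at hb
    exact hq (hb ▸ ha)
  · rw [he]
    intro e hm
    rw [List.mem_append, List.mem_singleton] at hm
    rcases hm with hm | rfl
    · exact h.adj e hm
    · exact hpq
  · intro e hm
    rw [he]
    exact List.mem_append_left _ hm

/-- A self-avoiding path can be prolonged along a straight line of fresh points. -/
theorem SelfAvoiding.extend {L : List Pos} (h : SelfAvoiding L) {p d : Pos} (hd : d ∈ Nvn)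
    (hp : L.getLast? = some p) (m : ℕ)
    (hfresh : ∀ k : ℕ, 1 ≤ k → k ≤ m → p + (k : ℤ) • d ∉ L) :
    ∃ L', SelfAvoiding L' ∧ L'.head? = L.head? ∧ L'.getLast? = some (p + (m : ℤ) • d) ∧
      (∀ x, x ∈ L' ↔ x ∈ L ∨ ∃ k : ℕ, 1 ≤ k ∧ k ≤ m ∧ x = p + (k : ℤ) • d) ∧
      ∀ e ∈ edges L, e ∈ edges L' := by
  induction m with
  | zero =>
    refine ⟨L, h, rfl, by simpa using hp, fun x => ⟨Or.inl, ?_⟩, fun _ => id⟩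
    rintro (hx | ⟨k, h1, h2, -⟩)
    · exact hx
    · omega
  | succ m ih =>
    obtain ⟨L', h1, h2, h3, h4, h5⟩ := ih fun k hk hk' => hfresh k hk (by omega)
    have hq : p + ((m + 1 : ℕ) : ℤ) • d ∉ L' := by
      rw [h4]
      rintro (hx | ⟨k, g1, g2, g3⟩)
      · exact hfresh _ (by omega) le_rfl hx
      · rw [add_right_inj] at g3
        have : ((m + 1 : ℕ) : ℤ) = k := by
          rw [mem_Nvn_iff] at hd
          rcases hd with rfl | rfl | rfl | rfl <;> simp [Prod.ext_iff] at g3 <;> push_cast <;> omega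
        omega
    obtain ⟨g1, g2⟩ := h1.append_one h3 hq (by
      have : p + ((m + 1 : ℕ) : ℤ) • d - (p + (m : ℤ) • d) = d := by
        push_cast
        rw [add_smul, one_smul]
        abel
      rwa [this])
    refine ⟨_, g1, ?_, by simp, ?_, fun e he => g2 e (h5 e he)⟩
    · rw [List.head?_append, h2]
      cases L with
      | nil => simp at hp
      | cons a L => rfl
    · intro x
      rw [List.mem_append, h4, List.mem_singleton]
      constructor
      · rintro ((hx | ⟨k, a, b, c⟩) | rfl)
        · exact Or.inl hx
        · exact Or.inr ⟨k, a, by omega, c⟩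
        · exact Or.inr ⟨m + 1, by omega, le_rfl, rfl⟩
      · rintro (hx | ⟨k, a, b, c⟩)
        · exact Or.inl (Or.inl hx)
        · rcases Nat.lt_or_ge m k with hk | hk
          · obtain rfl : k = m + 1 := by omega
            exact Or.inr c
          · exact Or.inl (Or.inr ⟨k, a, hk, c⟩)

/-- A detour through fresh points can be inserted in a self-avoiding path. -/
theorem SelfAvoiding.detour {L : List Pos} (h : SelfAvoiding L) {p q a b c d : Pos}
    (hpq : (p, q) ∈ edges L) (hnd : [a, b, c, d].Nodup) (hfresh : ∀ x ∈ [a, b, c, d], x ∉ L)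
    (hpa : a - p ∈ Nvn) (hab : b - a ∈ Nvn) (hbc : c - b ∈ Nvn) (hcd : d - c ∈ Nvn)
    (hdq : q - d ∈ Nvn) :
    ∃ L', SelfAvoiding L' ∧ L'.head? = L.head? ∧ L'.getLast? = L.getLast? ∧
      (∀ x, x ∈ L' ↔ x ∈ L ∨ x ∈ [a, b, c, d]) ∧
      (∀ e ∈ edges L, e ≠ (p, q) → e ∈ edges L') ∧
      (a, b) ∈ edges L' ∧ (b, c) ∈ edges L' ∧ (c, d) ∈ edges L' := by
  obtain ⟨A, B, rfl⟩ := exists_of_mem_edges hpq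
  have e1 : edges (A ++ p :: q :: B) = edges (A ++ [p]) ++ (p, q) :: edges (q :: B) := by
    rw [edges_append]; rfl
  have e2 : edges (A ++ p :: a :: b :: c :: d :: q :: B) = edges (A ++ [p]) ++
      (p, a) :: (a, b) :: (b, c) :: (c, d) :: (d, q) :: edges (q :: B) := by
    rw [edges_append]; rfl
  have hperm : (A ++ p :: a :: b :: c :: d :: q :: B).Perm
      ([a, b, c, d] ++ (A ++ p :: q :: B)) := by
    have := (List.perm_append_comm_assoc (A ++ [p]) [a, b, c, d] (q :: B))
    simpa using this
  refine ⟨A ++ p :: a :: b :: c :: d :: q :: B, ⟨?_, ?_⟩, ?_, ?_, ?_, ?_, ?_, ?_, ?_⟩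
  · rw [hperm.nodup_iff, List.nodup_append]
    exact ⟨hnd, h.nodup, fun x hx y hy hxy => hfresh x hx (hxy ▸ hy)⟩
  · rw [e2]
    have := h.adj
    rw [e1] at this
    intro e he
    simp only [List.mem_append, List.mem_cons] at he this
    rcases he with he | rfl | rfl | rfl | rfl | rfl | he
    · exact this e (Or.inl he)
    all_goals first | assumption | exact this e (Or.inr (Or.inr he))
  · cases A <;> rfl
  · simp [List.getLast?_append, List.getLast?_cons]
  · intro x
    rw [hperm.mem_iff, List.mem_append, or_comm]
  · intro e he hne
    rw [e1] at he
    rw [e2]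
    simp only [List.mem_append, List.mem_cons] at he ⊢
    tauto
  all_goals
    rw [e2]
    simp

/-- The four directions of the square grid. -/
inductive Dir : Type
  | e | n | w | s

namespace Dir

def vec : Dir → Pos
  | e => (1, 0)
  | n => (0, 1)
  | w => (-1, 0)
  | s => (0, -1)

def opp : Dir → Dir
  | e => w
  | n => s
  | w => e
  | s => n

theorem vec_mem (d : Dir) : d.vec ∈ Nvn := by cases d <;> simp [vec, Nvn]

theorem vec_opp (d : Dir) : d.opp.vec = -d.vec := by cases d <;> simp [vec, opp]

theorem vec_injective : Function.Injective vec := by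
  rintro (_ | _ | _ | _) (_ | _ | _ | _) h <;> simp_all [vec]

instance : Finite Dir :=
  have : Finite {x // x ∈ Nvn} := finite_Nvn.to_subtype
  Finite.of_injective (fun d => (⟨d.vec, d.vec_mem⟩ : {x // x ∈ Nvn}))
    fun _ _ h => vec_injective (congrArg Subtype.val h)

theorem exists_vec {w : Pos} (h : w ∈ Nvn) : ∃ d : Dir, d.vec = w := by
  rw [mem_Nvn_iff] at h
  rcases h with rfl | rfl | rfl | rfl
  exacts [⟨n, rfl⟩, ⟨e, rfl⟩, ⟨s, rfl⟩, ⟨w, rfl⟩]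

end Dir

/-- The 2×2 block containing a point. -/
def blk (p : Pos) : Pos := (p.1 / 2, p.2 / 2)

/-- The two points of a block lying along one of its sides. -/
def side (c : Pos) : Dir → Pos × Pos
  | .e => ((2 * c.1 + 1, 2 * c.2), (2 * c.1 + 1, 2 * c.2 + 1))
  | .n => ((2 * c.1, 2 * c.2 + 1), (2 * c.1 + 1, 2 * c.2 + 1))
  | .w => ((2 * c.1, 2 * c.2), (2 * c.1, 2 * c.2 + 1))
  | .s => ((2 * c.1, 2 * c.2), (2 * c.1 + 1, 2 * c.2))

theorem side_inj {c c' : Pos} {d d' : Dir} (h : side c d = side c' d') : c = c' ∧ d = d' := by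
  obtain ⟨x, y⟩ := c
  obtain ⟨x', y'⟩ := c'
  cases d <;> cases d' <;> simp [side] at h ⊢ <;> omega

theorem side_ne_swap (c c' : Pos) (d d' : Dir) : side c d ≠ (side c' d').swap := by
  obtain ⟨x, y⟩ := c
  obtain ⟨x', y'⟩ := c'
  cases d <;> cases d' <;> simp [side] <;> omega

/-- The path runs along the given side of the given block. -/
def HasSide (L : List Pos) (c : Pos) (d : Dir) : Prop :=
  side c d ∈ edges L ∨ (side c d).swap ∈ edges L

/-- A self-avoiding path running along a side can be extended to fill the block across. -/
theorem SelfAvoiding.grow_one {L : List Pos} (h : SelfAvoiding L) {c : Pos} {d : Dir}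
    (hs : HasSide L c d) (hfresh : ∀ p ∈ L, blk p ≠ c + d.vec) :
    ∃ L', SelfAvoiding L' ∧ L'.head? = L.head? ∧ L'.getLast? = L.getLast? ∧
      (∀ p, p ∈ L' ↔ p ∈ L ∨ blk p = c + d.vec) ∧
      (∀ c' d', HasSide L c' d' → (c', d') ≠ (c, d) → HasSide L' c' d') ∧
      ∀ d', d' ≠ d.opp → HasSide L' (c + d.vec) d' := by
  obtain ⟨e, he, hc⟩ : ∃ e ∈ edges L, e = side c d ∨ e = (side c d).swap := by
    rcases hs with hs | hs
    exacts [⟨_, hs, Or.inl rfl⟩, ⟨_, hs, Or.inr rfl⟩]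
  obtain ⟨L', g1, g2, g3, g4, g5, g6, g7, g8⟩ := h.detour (p := e.1) (q := e.2)
    (a := e.1 + d.vec) (b := e.1 + d.vec + d.vec) (c := e.2 + d.vec + d.vec)
    (d := e.2 + d.vec) he (by
      rcases hc with rfl | rfl <;> cases d <;> simp [side, Dir.vec, Prod.ext_iff])
    (by
      intro p hp hpL
      refine hfresh p hpL ?_
      rcases hc with rfl | rfl <;> cases d <;>
        simp [side, Dir.vec] at hp <;>
        rcases hp with rfl | rfl | rfl | rfl <;> simp [blk, Dir.vec, Prod.ext_iff] <;> omega)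
    (by simpa using d.vec_mem) (by simpa using d.vec_mem)
    (by
      rw [add_sub_add_right_eq_sub, add_sub_add_right_eq_sub]
      exact h.adj e he)
    (by simpa using neg_mem_Nvn d.vec_mem) (by simpa using neg_mem_Nvn d.vec_mem)
  refine ⟨L', g1, g2, g3, ?_, ?_, ?_⟩
  · intro p
    rw [g4]
    refine or_congr Iff.rfl ?_
    obtain ⟨x, y⟩ := c
    obtain ⟨a, b⟩ := p
    rcases hc with rfl | rfl <;> cases d <;>
        simp [side, Dir.vec, blk, Prod.ext_iff] <;> omega
  · rintro c' d' hs' hne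
    have h1 : side c' d' ≠ side c d := fun h => hne (by
      obtain ⟨rfl, rfl⟩ := side_inj h; rfl)
    have h2 := side_ne_swap c' c d' d
    have h3 := side_ne_swap c c' d d'
    refine hs'.imp (fun hh => g5 _ hh ?_) (fun hh => g5 _ hh ?_)
    · rcases hc with rfl | rfl
      exacts [h1, h2]
    · rcases hc with rfl | rfl
      exacts [h3.symm, fun h => h1 (Prod.swap_injective h)]
  · intro d' hd'
    obtain ⟨x, y⟩ := c
    rcases hc with rfl | rfl <;> cases d <;> cases d' <;>
      first
      | exact absurd rfl hd'
      | (left; refine cast (congrArg (· ∈ edges L') ?_) g6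
         simp [side, Dir.vec, Prod.ext_iff]
         omega)
      | (left; refine cast (congrArg (· ∈ edges L') ?_) g7
         simp [side, Dir.vec, Prod.ext_iff]
         omega)
      | (left; refine cast (congrArg (· ∈ edges L') ?_) g8
         simp [side, Dir.vec, Prod.ext_iff]
         omega)
      | (right; refine cast (congrArg (· ∈ edges L') ?_) g6
         simp [side, Dir.vec, Prod.ext_iff]
         omega)
      | (right; refine cast (congrArg (· ∈ edges L') ?_) g7
         simp [side, Dir.vec, Prod.ext_iff]
         omega)
      | (right; refine cast (congrArg (· ∈ edges L') ?_) g8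
         simp [side, Dir.vec, Prod.ext_iff]
         omega)

/-- Two positions are joined by a path inside a set. -/
def Joined (A : Set Pos) : Pos → Pos → Prop :=
  Relation.ReflTransGen fun x y => x ∈ A ∧ y ∈ A ∧ y - x ∈ Nvn

theorem Joined.symm {A : Set Pos} {x y : Pos} (h : Joined A x y) : Joined A y x := by
  induction h with
  | refl => exact Relation.ReflTransGen.refl
  | tail _ h ih =>
    refine Relation.ReflTransGen.head ⟨h.2.1, h.1, ?_⟩ ih
    rw [← neg_sub]
    exact neg_mem_Nvn h.2.2

theorem Joined.trans {A : Set Pos} {x y z : Pos} (h : Joined A x y) (h' : Joined A y z) :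
    Joined A x z :=
  Relation.ReflTransGen.trans h h'

theorem joined_segment {A : Set Pos} {d : Pos} (hd : d ∈ Nvn) {x : Pos} (m : ℕ)
    (h : ∀ k : ℕ, k ≤ m → x + (k : ℤ) • d ∈ A) : Joined A x (x + (m : ℤ) • d) := by
  induction m with
  | zero =>
    rw [Nat.cast_zero, zero_smul, add_zero]
    exact Relation.ReflTransGen.refl
  | succ m ih =>
    refine Relation.ReflTransGen.tail (ih fun k hk => h k (by omega)) ⟨h m (by omega),
      h (m + 1) le_rfl, ?_⟩
    rw [add_sub_add_left_eq_sub, ← sub_smul]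
    simpa using hd

/-- A self-avoiding path running along a side of a block can be extended to fill a connected
set of fresh blocks containing the block across this side. -/
theorem SelfAvoiding.grow {L : List Pos} (h : SelfAvoiding L) {b : Pos} {d₀ : Dir}
    (hs : HasSide L b d₀) {A : Set Pos} (hA : A.Finite) (hc : b + d₀.vec ∈ A) (hb : b ∉ A)
    (hfresh : ∀ p ∈ L, blk p ∉ A) (hconn : ∀ a ∈ A, Joined A (b + d₀.vec) a) :
    ∃ L', SelfAvoiding L' ∧ L'.head? = L.head? ∧ L'.getLast? = L.getLast? ∧
      (∀ p, p ∈ L' ↔ p ∈ L ∨ blk p ∈ A) ∧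
      ∀ c' d', HasSide L c' d' → c' ∉ A → (c', d') ≠ (b, d₀) → HasSide L' c' d' := by
  suffices key : ∀ m : ℕ, ∀ D : Set Pos, D ⊆ A → b + d₀.vec ∈ D → (A \ D).ncard = m →
      ∀ L₁, SelfAvoiding L₁ → L₁.head? = L.head? → L₁.getLast? = L.getLast? →
      (∀ p, p ∈ L₁ ↔ p ∈ L ∨ blk p ∈ D) →
      (∀ c' d', HasSide L c' d' → c' ∉ A → (c', d') ≠ (b, d₀) → HasSide L₁ c' d') →
      (∀ c ∈ D, ∀ d : Dir, c + d.vec ∈ A \ D → HasSide L₁ c d) →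
      ∃ L', SelfAvoiding L' ∧ L'.head? = L.head? ∧ L'.getLast? = L.getLast? ∧
      (∀ p, p ∈ L' ↔ p ∈ L ∨ blk p ∈ A) ∧
      ∀ c' d', HasSide L c' d' → c' ∉ A → (c', d') ≠ (b, d₀) → HasSide L' c' d' by
    obtain ⟨L₁, g1, g2, g3, g4, g5, g6⟩ := h.grow_one hs fun p hp e => hfresh p hp (e ▸ hc)
    refine key _ {b + d₀.vec} (Set.singleton_subset_iff.2 hc) rfl rfl L₁ g1 g2 g3 (by simpa using g4)
      (fun c' d' h1 _ h2 => g5 c' d' h1 h2) ?_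
    rintro c hcD d hd
    obtain rfl : c = b + d₀.vec := hcD
    refine g6 d ?_
    rintro rfl
    rw [Dir.vec_opp, add_neg_cancel_right] at hd
    exact hb hd.1
  intro m
  induction m with
  | zero =>
    intro D hD _ hm L₁ g1 g2 g3 g4 g5 _
    have hAD : A = D := by
      rw [Set.ncard_eq_zero (hA.subset Set.sdiff_subset)] at hm
      exact (Set.sdiff_eq_empty.1 hm).antisymm hD
    refine ⟨L₁, g1, g2, g3, ?_, g5⟩
    rwa [hAD]
  | succ m ih =>
    intro D hD hcD hm L₁ g1 g2 g3 g4 g5 g6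
    obtain ⟨c, hc1, d, hd1⟩ : ∃ c ∈ D, ∃ d : Dir, c + d.vec ∈ A \ D := by
      by_contra! hno
      have : A ⊆ D := by
        intro a ha
        have := hconn a ha
        clear ha
        induction this with
        | refl => exact hcD
        | tail _ h1 ih1 =>
          obtain ⟨d, hd⟩ := Dir.exists_vec h1.2.2
          have h2 := hno _ ih1 d
          rw [hd, add_sub_cancel] at h2
          by_contra h3
          exact h2 ⟨h1.2.1, h3⟩
      rw [Set.sdiff_eq_empty.2 this] at hm
      simp at hm
    obtain ⟨L₂, k1, k2, k3, k4, k5, k6⟩ := g1.grow_one (g6 c hc1 d hd1) (by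
      intro p hp e
      rcases (g4 p).1 hp with hp | hp
      · exact hfresh p hp (e ▸ hd1.1)
      · exact hd1.2 (e ▸ hp))
    refine ih (insert (c + d.vec) D) (Set.insert_subset hd1.1 hD) (Set.mem_insert_of_mem _ hcD) ?_
      L₂ k1 (k2.trans g2) (k3.trans g3) ?_ ?_ ?_
    · have e : A \ insert (c + d.vec) D = (A \ D) \ {c + d.vec} := by
        rw [Set.sdiff_sdiff, Set.union_comm, Set.singleton_union]
      have := Set.ncard_sdiff_singleton_add_one hd1 (hA.subset Set.sdiff_subset)
      rw [e]
      omega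
    · intro p
      rw [k4, g4, Set.mem_insert_iff, or_assoc, or_comm (a := blk p ∈ D)]
    · intro c' d' h1 h2 h3
      refine k5 _ _ (g5 c' d' h1 h2 h3) ?_
      intro e
      obtain ⟨rfl, rfl⟩ := Prod.mk.inj e
      exact h2 (hD hc1)
    · intro c' hc' d' hd'
      rw [Set.mem_sdiff, Set.mem_insert_iff, not_or] at hd'
      rcases hc' with rfl | hc'
      · refine k6 d' ?_
        rintro rfl
        rw [Dir.vec_opp, add_neg_cancel_right] at hd'
        exact hd'.2.2 hc1
      · refine k5 _ _ (g6 c' hc' d' ⟨hd'.1, hd'.2.2⟩) ?_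
        intro e
        obtain ⟨rfl, rfl⟩ := Prod.mk.inj e
        exact hd'.2.1 rfl

section Geometry

theorem joined_row {A : Set Pos} {x x' y : ℤ} (hx : x ≤ x')
    (h : ∀ z, x ≤ z → z ≤ x' → (z, y) ∈ A) : Joined A (x, y) (x', y) := by
  have := joined_segment (A := A) (d := (1, 0)) (by simp [Nvn]) (x := (x, y)) (x' - x).toNat
    (fun k hk => by simpa using h (x + k) (by omega) (by omega))
  have e : ((x' - x).toNat : ℤ) = x' - x := Int.toNat_of_nonneg (by omega)
  rw [e] at this
  simpa using this

theorem joined_column {A : Set Pos} {x y y' : ℤ} (hy : y ≤ y')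
    (h : ∀ z, y ≤ z → z ≤ y' → (x, z) ∈ A) : Joined A (x, y) (x, y') := by
  have := joined_segment (A := A) (d := (0, 1)) (by simp [Nvn]) (x := (x, y)) (y' - y).toNat
    (fun k hk => by simpa using h (y + k) (by omega) (by omega))
  have e : ((y' - y).toNat : ℤ) = y' - y := Int.toNat_of_nonneg (by omega)
  rw [e] at this
  simpa using this

/-- The corners of a square. -/
abbrev Role : Type := Bool × Bool

def off (j : Role) : Pos := (if j.1 then 1 else 0, if j.2 then 1 else 0)

/-- The four corners of a square use nested levels, numbered from `0` to `3`. -/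
def lev (j : Role) : ℤ := (if j.1 then 1 else 0) + (if j.2 then 2 else 0)

/-- In a square of width `S`, the strand attached to the corner `j`: a column joining the corner
to a row, and this row, with a bump around the abscissa `X`. -/
def strand (S X : ℤ) (j : Role) : Set Pos := {q |
  (q.1 = (if j.1 then S else 2) ∧ (if j.2 then 3 + lev j else 3) ≤ q.2 ∧
    q.2 ≤ (if j.2 then S - 1 else 3 + lev j)) ∨
  (2 + (off j).1 ≤ q.1 ∧ q.1 ≤ S - 1 + (off j).1 ∧
    ((q.2 = 3 + lev j ∧ (q.1 ≤ X - lev j ∨ X + lev j ≤ q.1)) ∨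
      ((q.1 = X - lev j ∨ q.1 = X + lev j) ∧ 3 + lev j ≤ q.2 ∧ q.2 ≤ 7 + lev j) ∨
      (X - lev j ≤ q.1 ∧ q.1 ≤ X + lev j ∧ q.2 = 7 + lev j)))}

/-- The first block of a strand. -/
def strandStart (S : ℤ) (j : Role) : Pos := (if j.1 then S else 2, if j.2 then S - 1 else 3)

variable {S X X' : ℤ} {j j' : Role} {q : Pos}

theorem strand_box (hS : X + 14 ≤ S) (hX : 7 ≤ X) (h : q ∈ strand S X j) :
    2 ≤ q.1 ∧ q.1 ≤ S ∧ 3 ≤ q.2 ∧ q.2 ≤ S - 1 := by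
  obtain ⟨x, y⟩ := q
  rcases j with ⟨_ | _, _ | _⟩ <;> simp [strand, lev, off] at h ⊢ <;> omega

theorem finite_strand (hS : X + 14 ≤ S) (hX : 7 ≤ X) : (strand S X j).Finite := by
  refine (Set.finite_Icc ((2, 3) : Pos) (S, S - 1)).subset fun q hq => ?_
  have := strand_box hS hX hq
  exact ⟨⟨this.1, this.2.2.1⟩, ⟨this.2.1, this.2.2.2⟩⟩

theorem strand_disj (hS : X + 14 ≤ S) (hX : 7 ≤ X) (h : q ∈ strand S X j)
    (h' : q ∈ strand S X j') : j = j' := by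
  obtain ⟨x, y⟩ := q
  rcases j with ⟨_ | _, _ | _⟩ <;> rcases j' with ⟨_ | _, _ | _⟩ <;>
    simp [strand, lev, off] at h h' ⊢ <;> omega

theorem strand_meet (hS : X + 14 ≤ S) (hX : 7 ≤ X) (hS' : X' + 14 ≤ S) (hX' : 7 ≤ X')
    (hXX' : X + 7 ≤ X' ∨ X' + 7 ≤ X) (hj : j ≠ j') :
    ∃ q, q ∈ strand S X j ∧ q ∈ strand S X' j' := by
  by_cases hl : lev j < lev j'
  · refine ⟨(X - lev j, 3 + lev j'), ?_⟩
    rcases j with ⟨_ | _, _ | _⟩ <;> rcases j' with ⟨_ | _, _ | _⟩ <;>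
      simp [strand, lev, off] at hl hj ⊢ <;> omega
  · refine ⟨(X' - lev j', 3 + lev j), ?_⟩
    rcases j with ⟨_ | _, _ | _⟩ <;> rcases j' with ⟨_ | _, _ | _⟩ <;>
      simp [strand, lev, off] at hl hj ⊢ <;> omega

theorem strandStart_mem (hS : X + 14 ≤ S) (hX : 7 ≤ X) : strandStart S j ∈ strand S X j := by
  rcases j with ⟨_ | _, _ | _⟩ <;> simp [strand, lev, strandStart] <;> omega

theorem lev_bounds (j : Role) : 0 ≤ lev j ∧ lev j ≤ 3 := by
  rcases j with ⟨_ | _, _ | _⟩ <;> simp [lev]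

theorem off_bounds (j : Role) : 0 ≤ (off j).1 ∧ (off j).1 ≤ 1 := by
  rcases j with ⟨_ | _, _ | _⟩ <;> simp [off]

theorem row_mem_strand {x : ℤ} (h1 : 2 + (off j).1 ≤ x) (h2 : x ≤ S - 1 + (off j).1)
    (h3 : x ≤ X - lev j ∨ X + lev j ≤ x) : (x, 3 + lev j) ∈ strand S X j :=
  Or.inr ⟨h1, h2, Or.inl ⟨rfl, h3⟩⟩

theorem wall_mem_strand {x y : ℤ} (hS : X + 14 ≤ S) (hX : 7 ≤ X)
    (hx : x = X - lev j ∨ x = X + lev j) (h1 : 3 + lev j ≤ y) (h2 : y ≤ 7 + lev j) :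
    (x, y) ∈ strand S X j := by
  have := lev_bounds j
  have := off_bounds j
  exact Or.inr ⟨by dsimp only; omega, by dsimp only; omega, Or.inr (Or.inl ⟨hx, h1, h2⟩)⟩

theorem roof_mem_strand {x : ℤ} (hS : X + 14 ≤ S) (hX : 7 ≤ X)
    (h1 : X - lev j ≤ x) (h2 : x ≤ X + lev j) : (x, 7 + lev j) ∈ strand S X j := by
  have := lev_bounds j
  have := off_bounds j
  exact Or.inr ⟨by dsimp only; omega, by dsimp only; omega, Or.inr (Or.inr ⟨h1, h2, rfl⟩)⟩

theorem joined_column_strand {y : ℤ} (h1 : (if j.2 then 3 + lev j else 3) ≤ y)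
    (h2 : y ≤ (if j.2 then S - 1 else 3 + lev j)) :
    Joined (strand S X j) (strandStart S j) (if j.1 then S else 2, y) := by
  rcases j with ⟨j₁, _ | _⟩
  · refine joined_column (by simpa using h1) fun z h3 h4 => Or.inl ⟨rfl, ?_, ?_⟩
    · simpa using h3
    · simp at h2 ⊢
      omega
  · refine (joined_column (by simpa using h2) fun z h3 h4 => Or.inl ⟨rfl, ?_, ?_⟩).symm
    · simp at h1 ⊢
      omega
    · simpa using h4

theorem strand_joined (hS : X + 14 ≤ S) (hX : 7 ≤ X) (h : q ∈ strand S X j) :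
    Joined (strand S X j) (strandStart S j) q := by
  obtain ⟨x, y⟩ := q
  have hlev := lev_bounds j
  have hoff := off_bounds j
  have hl : Joined (strand S X j) (X - lev j, 3 + lev j) (X - lev j, 7 + lev j) :=
    joined_column (by omega) fun z => wall_mem_strand hS hX (Or.inl rfl)
  have ht : Joined (strand S X j) (X - lev j, 7 + lev j) (X + lev j, 7 + lev j) :=
    joined_row (by omega) fun z => roof_mem_strand hS hX
  have hr : Joined (strand S X j) (X + lev j, 3 + lev j) (X + lev j, 7 + lev j) :=
    joined_column (by omega) fun z => wall_mem_strand hS hX (Or.inr rfl)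
  have hleft : ∀ x, 2 + (off j).1 ≤ x → x ≤ X - lev j →
      Joined (strand S X j) (x, 3 + lev j) (X - lev j, 3 + lev j) := fun x hx hx' =>
    joined_row hx' fun z _ hz => row_mem_strand (by omega) (by omega) (Or.inl hz)
  have hright : ∀ x, X + lev j ≤ x → x ≤ S - 1 + (off j).1 →
      Joined (strand S X j) (X + lev j, 3 + lev j) (x, 3 + lev j) := fun x hx hx' =>
    joined_row hx fun z hz _ => row_mem_strand (by omega) (by omega) (Or.inr hz)
  have hcorner : Joined (strand S X j) (strandStart S j) (if j.1 then S else 2, 3 + lev j) := by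
    refine joined_column_strand ?_ ?_ <;> split_ifs <;> omega
  have hbase : Joined (strand S X j) (strandStart S j) (X - lev j, 3 + lev j) := by
    rcases j with ⟨_ | _, j₂⟩
    · exact hcorner.trans (hleft 2 (by simp [off]) (by omega))
    · exact hcorner.trans ((hright S (by omega) (by simp [off])).symm.trans (hr.trans
        (ht.symm.trans hl.symm)))
  have hbase' := hbase.trans (hl.trans (ht.trans hr.symm))
  rcases h with ⟨h1, h2, h3⟩ | ⟨h1, h2, ⟨h3, h4 | h4⟩ | ⟨h3 | h3, h4, h5⟩ | ⟨h3, h4, h5⟩⟩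
  · obtain rfl : x = _ := h1
    exact joined_column_strand h2 h3
  · obtain rfl : y = _ := h3
    exact hbase.trans (hleft x h1 h4).symm
  · obtain rfl : y = _ := h3
    exact hbase'.trans (hright x h4 h2)
  · obtain rfl : x = _ := h3
    exact hbase.trans (joined_column h4 fun z hz hz' =>
      wall_mem_strand hS hX (Or.inl rfl) hz (hz'.trans h5))
  · obtain rfl : x = _ := h3
    exact hbase'.trans (joined_column h4 fun z hz hz' =>
      wall_mem_strand hS hX (Or.inr rfl) hz (hz'.trans h5))
  · obtain rfl : y = _ := h5
    exact hbase.trans (hl.trans (joined_row h3 fun z hz hz' =>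
      roof_mem_strand hS hX hz (hz'.trans h4)))

end Geometry

section Geometry

/-- The blocks of a cell of width `S` used by the central part of its path and by the arms
leading to its north and east neighbours. -/
def base (S : ℤ) : Set Pos := {p |
  (0 ≤ p.1 ∧ p.1 ≤ 2 ∧ 0 ≤ p.2 ∧ p.2 ≤ 2) ∨ (3 ≤ p.1 ∧ p.1 ≤ S - 1 ∧ p.2 = 1) ∨
    (3 ≤ p.2 ∧ p.2 ≤ S - 1 ∧ p.1 = 1)}

theorem scale_cancel {S a b x y : ℤ} (h : S * a + x = S * b + y) (h1 : x - y < S)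
    (h2 : y - x < S) : a = b := by
  by_contra hab
  rcases lt_or_gt_of_ne hab with hab | hab <;> nlinarith

variable {S X X' : ℤ} {j j' : Role} {u v c c' q q' : Pos}

theorem base_base (hS : 14 ≤ S) (hc : c ∈ base S) (hc' : c' ∈ base S)
    (h : sc S u + c = sc S v + c') : u = v := by
  simp only [sc, Prod.ext_iff, Prod.fst_add, Prod.snd_add] at h
  have h1 : 0 ≤ c.1 ∧ c.1 < S ∧ 0 ≤ c.2 ∧ c.2 < S := by
    rcases hc with h | h | h <;> omega
  have h2 : 0 ≤ c'.1 ∧ c'.1 < S ∧ 0 ≤ c'.2 ∧ c'.2 < S := by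
    rcases hc' with h | h | h <;> omega
  exact Prod.ext (scale_cancel h.1 (by omega) (by omega)) (scale_cancel h.2 (by omega) (by omega))

theorem base_strand (hS : X + 14 ≤ S) (hX : 7 ≤ X) (hc : c ∈ base S) (hq : q ∈ strand S X j) :
    sc S u + c ≠ sc S v + q := by
  intro h
  simp only [sc, Prod.ext_iff, Prod.fst_add, Prod.snd_add] at h
  have h1 : 0 ≤ c.2 ∧ c.2 < S ∧ (3 ≤ c.2 → c.1 = 1) := by
    rcases hc with h | h | h <;> omega
  have h2 := strand_box hS hX hq
  have h3 := scale_cancel h.2 (by omega) (by omega)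
  rw [h3] at h
  have h4 : c.1 = 1 := h1.2.2 (by omega)
  have h5 := scale_cancel h.1 (by omega) (by omega)
  rw [h5] at h
  omega

theorem strand_strand (hS : X + 14 ≤ S) (hX : 7 ≤ X) (hS' : X' + 14 ≤ S) (hX' : 7 ≤ X')
    (hq : q ∈ strand S X j) (hq' : q' ∈ strand S X' j') (h : sc S u + q = sc S v + q') :
    u = v ∧ q = q' := by
  have h1 := strand_box hS hX hq
  have h2 := strand_box hS' hX' hq'
  have huv : u = v := by
    simp only [sc, Prod.ext_iff, Prod.fst_add, Prod.snd_add] at h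
    exact Prod.ext (scale_cancel h.1 (by omega) (by omega))
      (scale_cancel h.2 (by omega) (by omega))
  subst huv
  exact ⟨rfl, add_left_cancel h⟩

theorem off_injective : Function.Injective off := by
  rintro ⟨_ | _, _ | _⟩ ⟨_ | _, _ | _⟩ h <;> simp_all [off]

/-- The blocks, relative to a cell, of the strand attached to this cell in the square of which
the cell is the corner `j`. -/
def cellStrand (S X : ℤ) (j : Role) : Set Pos := {b | b + sc S (off j) ∈ strand S X j}

theorem Joined.translate {A : Set Pos} {x y : Pos} (t : Pos) (h : Joined A x y) :
    Joined {b | b + t ∈ A} (x - t) (y - t) := by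
  induction h with
  | refl => exact Relation.ReflTransGen.refl
  | tail _ h ih => exact ih.tail (by simpa using h)

theorem finite_cellStrand (hS : X + 14 ≤ S) (hX : 7 ≤ X) : (cellStrand S X j).Finite :=
  (finite_strand hS hX).preimage (add_left_injective _).injOn

/-- The block of the central part of a cell, and its side, where a strand starts. -/
def stub (j : Role) : Pos × Dir :=
  ((if j.1 then 0 else 2, if j.2 then 0 else 2), if j.2 then .s else .n)

theorem stub_injective {j j' : Role} (h : stub j = stub j') : j = j' := by
  revert h
  rcases j with ⟨_ | _, _ | _⟩ <;> rcases j' with ⟨_ | _, _ | _⟩ <;> simp [stub]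

theorem stub_next : (stub j).1 + (stub j).2.vec = strandStart S j - sc S (off j) := by
  rcases j with ⟨_ | _, _ | _⟩ <;> simp [stub, strandStart, off, sc, Dir.vec]

theorem stub_mem_base : (stub j).1 ∈ base S := by
  rcases j with ⟨_ | _, _ | _⟩ <;> simp [stub, base]

theorem stub_next_mem (hS : X + 14 ≤ S) (hX : 7 ≤ X) :
    (stub j).1 + (stub j).2.vec ∈ cellStrand S X j := by
  rw [stub_next (S := S), cellStrand, Set.mem_ofPred_eq, sub_add_cancel]
  exact strandStart_mem hS hX

theorem cellStrand_joined (hS : X + 14 ≤ S) (hX : 7 ≤ X) {b : Pos} (hb : b ∈ cellStrand S X j) :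
    Joined (cellStrand S X j) ((stub j).1 + (stub j).2.vec) b := by
  have := (strand_joined hS hX hb).translate (sc S (off j))
  rwa [add_sub_cancel_right, ← stub_next] at this

theorem notMem_cellStrand_of_mem_base (hS : X + 14 ≤ S) (hX : 7 ≤ X) (hc : c ∈ base S) :
    c ∉ cellStrand S X j := by
  intro h
  refine base_strand hS hX (u := off j) (v := 0) hc h ?_
  simp [sc, Prod.ext_iff, add_comm]

theorem cellStrand_disj (hS : X + 14 ≤ S) (hX : 7 ≤ X) (hS' : X' + 14 ≤ S) (hX' : 7 ≤ X')
    (hc : c ∈ cellStrand S X j) (hc' : c ∈ cellStrand S X' j') : j = j' := by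
  refine off_injective (strand_strand hS hX hS' hX' hc hc' (u := off j') (v := off j) ?_).1.symm
  abel

end Geometry

/-- The points where paths cross the border of the central 6×6 square of a cell. -/
def hubPort : Dir → Pos
  | .e => (5, 2)
  | .n => (2, 5)
  | .w => (0, 2)
  | .s => (2, 0)

/-- A path crossing the central 6×6 square of a cell. -/
def hub : Dir → Dir → List Pos
  | .e, .n => [(5,2),(5,3),(5,4),(5,5),(4,5),(4,4),(4,3),(4,2),(4,1),(5,1),(5,0),(4,0),(3,0),(2,0),
      (1,0),(0,0),(0,1),(0,2),(0,3),(0,4),(0,5),(1,5),(2,5)]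
  | .e, .w => [(5,2),(5,1),(5,0),(4,0),(4,1),(4,2),(4,3),(5,3),(5,4),(5,5),(4,5),(3,5),(2,5),(1,5),
      (0,5),(0,4),(1,4),(1,3),(1,2),(1,1),(1,0),(0,0),(0,1),(0,2)]
  | .e, .s => [(5,2),(5,1),(5,0),(4,0),(4,1),(4,2),(4,3),(5,3),(5,4),(5,5),(4,5),(3,5),(2,5),(1,5),
      (0,5),(0,4),(0,3),(0,2),(0,1),(0,0),(1,0),(2,0)]
  | .n, .w => [(2,5),(1,5),(0,5),(0,4),(1,4),(2,4),(3,4),(4,4),(4,5),(5,5),(5,4),(5,3),(5,2),(5,1),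
      (5,0),(4,0),(3,0),(2,0),(1,0),(0,0),(0,1),(0,2)]
  | .n, .s => [(2,5),(1,5),(0,5),(0,4),(1,4),(2,4),(3,4),(4,4),(4,5),(5,5),(5,4),(5,3),(5,2),(5,1),
      (5,0),(4,0),(4,1),(3,1),(2,1),(1,1),(0,1),(0,0),(1,0),(2,0)]
  | .w, .s => [(0,2),(0,3),(0,4),(0,5),(1,5),(2,5),(3,5),(4,5),(5,5),(5,4),(5,3),(5,2),(5,1),(5,0),
      (4,0),(4,1),(3,1),(2,1),(1,1),(0,1),(0,0),(1,0),(2,0)]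
  | _, _ => []

/-- The properties of the central part of a path. -/
structure IsHub (L : List Pos) (i o : Dir) : Prop where
  path : SelfAvoiding L
  head : L.head? = some (hubPort i)
  last : L.getLast? = some (hubPort o)
  box : ∀ p ∈ L, 0 ≤ p.1 ∧ p.1 ≤ 5 ∧ 0 ≤ p.2 ∧ p.2 ≤ 5
  zero : (0, 0) ∈ L
  sides : ∀ j, HasSide L (stub j).1 (stub j).2

theorem HasSide.reverse {L : List Pos} {c : Pos} {d : Dir} (h : HasSide L c d) :
    HasSide L.reverse c d :=
  h.symm.imp mem_edges_reverse mem_edges_reverse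

theorem IsHub.reverse {L : List Pos} {i o : Dir} (h : IsHub L i o) : IsHub L.reverse o i where
  path := h.path.reverse
  head := by rw [List.head?_reverse, h.last]
  last := by rw [List.getLast?_reverse, h.head]
  box p hp := h.box p (List.mem_reverse.1 hp)
  zero := List.mem_reverse.2 h.zero
  sides j := (h.sides j).reverse

theorem isHub_hub {i o : Dir} (h : hub i o ≠ []) : IsHub (hub i o) i o := by
  constructor
  · constructor
    · cases i <;> cases o <;> first | exact absurd rfl h | decide
    · cases i <;> cases o <;> first | exact absurd rfl h | simp [hub, edges, Nvn]
  · cases i <;> cases o <;> first | exact absurd rfl h | rfl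
  · cases i <;> cases o <;> first | exact absurd rfl h | rfl
  · cases i <;> cases o <;> first | exact absurd rfl h | decide
  · cases i <;> cases o <;> first | exact absurd rfl h | decide
  · rintro ⟨_ | _, _ | _⟩ <;> cases i <;> cases o <;>
      first | exact absurd rfl h | simp [hub, edges, HasSide, stub, side]

theorem exists_isHub {i o : Dir} (h : i ≠ o) : ∃ L, IsHub L i o := by
  have : hub i o ≠ [] ∨ hub o i ≠ [] := by
    cases i <;> cases o <;> simp [hub] at h ⊢
  rcases this with h | h
  · exact ⟨_, isHub_hub h⟩
  · exact ⟨_, (isHub_hub h).reverse⟩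

section Geometry

/-- The length of the arm leading to a side of a cell. -/
def arm (S : ℤ) : Dir → ℕ
  | .e | .n => (2 * S - 6).toNat
  | .w | .s => 0

/-- The point where paths cross a side of a cell. -/
def port (S : ℤ) (d : Dir) : Pos := hubPort d + (arm S d : ℤ) • d.vec

variable {S : ℤ} {i o : Dir}

theorem blk_mem_base_of_hub {p : Pos} (h : 0 ≤ p.1 ∧ p.1 ≤ 5 ∧ 0 ≤ p.2 ∧ p.2 ≤ 5) :
    blk p ∈ base S := by
  left
  simp only [blk]
  omega

theorem blk_mem_base_of_arm {d : Dir} {k : ℕ} (hk : 1 ≤ k) (hk' : k ≤ arm S d) :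
    blk (hubPort d + (k : ℤ) • d.vec) ∈ base S := by
  cases d <;> simp [arm, hubPort, Dir.vec, blk, base] at hk' ⊢ <;> omega

theorem arm_notMem_hub {L : List Pos} {i o d : Dir} (h : IsHub L i o) {k : ℕ} (hk : 1 ≤ k) :
    k ≤ arm S d → hubPort d + (k : ℤ) • d.vec ∉ L := by
  intro hk' hp
  have := h.box _ hp
  cases d <;> simp [arm, hubPort, Dir.vec] at hk' this <;> omega

theorem arm_ne_arm {i o : Dir} (h : i ≠ o) {k l : ℕ} (hk : 1 ≤ k) (hk' : k ≤ arm S i)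
    (hl : 1 ≤ l) (hl' : l ≤ arm S o) :
    hubPort i + (k : ℤ) • i.vec ≠ hubPort o + (l : ℤ) • o.vec := by
  cases i <;> cases o <;>
    simp [arm, hubPort, Dir.vec] at h hk' hl' ⊢ <;> omega

/-- A path crossing a cell along the arms. -/
theorem exists_crossing (S : ℤ) (h : i ≠ o) : ∃ L, SelfAvoiding L ∧ L.head? = some (port S i) ∧
    L.getLast? = some (port S o) ∧ (∀ p ∈ L, blk p ∈ base S) ∧ (0, 0) ∈ L ∧
    ∀ j, HasSide L (stub j).1 (stub j).2 := by
  obtain ⟨L, hL⟩ := exists_isHub h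
  obtain ⟨L₁, a1, a2, a3, a4, a5⟩ := hL.path.extend o.vec_mem hL.last (arm S o)
    fun k hk hk' => arm_notMem_hub hL hk hk'
  obtain ⟨L₂, b1, b2, b3, b4, b5⟩ := a1.reverse.extend (p := hubPort i) i.vec_mem
    (by rw [List.getLast?_reverse, a2, hL.head]) (arm S i) (by
      intro k hk hk' hmem
      rw [List.mem_reverse, a4] at hmem
      rcases hmem with hmem | ⟨l, hl, hl', e⟩
      · exact arm_notMem_hub hL hk hk' hmem
      · exact arm_ne_arm h hk hk' hl hl' e)
  refine ⟨L₂.reverse, b1.reverse, ?_, ?_, ?_, ?_, fun j => ?_⟩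
  · rw [List.head?_reverse, b3, port]
  · rw [List.getLast?_reverse, b2, List.head?_reverse, a3, port]
  · intro p hp
    rw [List.mem_reverse, b4, List.mem_reverse, a4] at hp
    rcases hp with (hp | ⟨k, hk, hk', rfl⟩) | ⟨k, hk, hk', rfl⟩
    · exact blk_mem_base_of_hub (hL.box p hp)
    · exact blk_mem_base_of_arm hk hk'
    · exact blk_mem_base_of_arm hk hk'
  · rw [List.mem_reverse, b4, List.mem_reverse, a4]
    exact Or.inl (Or.inl hL.zero)
  · have h1 : HasSide L₁ (stub j).1 (stub j).2 := (hL.sides j).imp (a5 _) (a5 _)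
    exact HasSide.reverse (h1.reverse.imp (b5 _) (b5 _))

/-- Paths crossing a cell of width `S` and filling its strands in the four adjacent squares. -/
structure IsCrossing (S : ℤ) (X : Role → ℤ) (i o : Dir) (L : List Pos) : Prop where
  path : SelfAvoiding L
  head : L.head? = some (port S i)
  last : L.getLast? = some (port S o)
  zero : (0, 0) ∈ L
  sub : ∀ p ∈ L, blk p ∈ base S ∨ ∃ j, blk p ∈ cellStrand S (X j) j
  sup : ∀ p j, blk p ∈ cellStrand S (X j) j → p ∈ L

theorem exists_isCrossing {X : Role → ℤ} (hS : ∀ j, X j + 14 ≤ S) (hX : ∀ j, 7 ≤ X j)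
    (h : i ≠ o) : ∃ L, IsCrossing S X i o L := by
  suffices key : ∀ l : List Role, l.Nodup → ∃ L, SelfAvoiding L ∧ L.head? = some (port S i) ∧
      L.getLast? = some (port S o) ∧ (0, 0) ∈ L ∧
      (∀ p ∈ L, blk p ∈ base S ∨ ∃ j ∈ l, blk p ∈ cellStrand S (X j) j) ∧
      (∀ p, ∀ j ∈ l, blk p ∈ cellStrand S (X j) j → p ∈ L) ∧
      ∀ j, j ∉ l → HasSide L (stub j).1 (stub j).2 by
    obtain ⟨L, h1, h2, h3, h4, h5, h6, -⟩ :=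
      key [(false, false), (false, true), (true, false), (true, true)] (by simp)
    refine ⟨L, h1, h2, h3, h4, fun p hp => (h5 p hp).imp_right ?_, fun p j => h6 p j ?_⟩
    · exact fun ⟨j, _, hj⟩ => ⟨j, hj⟩
    · rcases j with ⟨_ | _, _ | _⟩ <;> simp
  intro l hl
  induction l with
  | nil =>
    obtain ⟨L, h1, h2, h3, h4, h5, h6⟩ := exists_crossing S h
    exact ⟨L, h1, h2, h3, h5, fun p hp => Or.inl (h4 p hp), by simp, fun j _ => h6 j⟩
  | cons j l ih =>
    rw [List.nodup_cons] at hl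
    obtain ⟨L, h1, h2, h3, h4, h5, h6, h7⟩ := ih hl.2
    obtain ⟨L', g1, g2, g3, g4, g5⟩ := h1.grow (h7 j hl.1) (finite_cellStrand (hS j) (hX j))
      (stub_next_mem (hS j) (hX j)) (notMem_cellStrand_of_mem_base (hS j) (hX j) stub_mem_base)
      (by
        intro p hp hp'
        rcases h5 p hp with hb | ⟨j', hj', hb⟩
        · exact notMem_cellStrand_of_mem_base (hS j) (hX j) hb hp'
        · obtain rfl := cellStrand_disj (hS j) (hX j) (hS j') (hX j') hp' hb
          exact hl.1 hj')
      (fun a ha => cellStrand_joined (hS j) (hX j) ha)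
    refine ⟨L', g1, g2.trans h2, g3.trans h3, (g4 _).2 (Or.inl h4), ?_, ?_, ?_⟩
    · intro p hp
      rcases (g4 p).1 hp with hp | hp
      · exact (h5 p hp).imp_right fun ⟨j', hj', hb⟩ => ⟨j', List.mem_cons_of_mem _ hj', hb⟩
      · exact Or.inr ⟨j, List.mem_cons_self, hp⟩
    · intro p j' hj' hb
      rw [g4]
      rcases List.mem_cons.1 hj' with rfl | hj'
      · exact Or.inr hb
      · exact Or.inl (h6 p j' hj' hb)
    · intro j' hj'
      rw [List.mem_cons, not_or] at hj'
      exact g5 _ _ (h7 j' hj'.2) (notMem_cellStrand_of_mem_base (hS j) (hX j) stub_mem_base)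
        fun e => hj'.1 (stub_injective e)

theorem port_add {d : Dir} (hS : 14 ≤ S) :
    port S d + d.vec = sc (2 * S) d.vec + port S d.opp := by
  have : ((2 * S - 6).toNat : ℤ) = 2 * S - 6 := Int.toNat_of_nonneg (by omega)
  cases d <;> simp [port, hubPort, arm, Dir.vec, Dir.opp, sc, this] <;> omega

theorem port_injective (hS : 14 ≤ S) : Function.Injective (port S) := by
  have : ((2 * S - 6).toNat : ℤ) = 2 * S - 6 := Int.toNat_of_nonneg (by omega)
  intro i o h
  cases i <;> cases o <;> simp [port, hubPort, arm, Dir.vec, this] at h ⊢ <;> omega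

theorem blk_port_add {d : Dir} (hS : 14 ≤ S) {X : Role → ℤ} (hXS : ∀ j, X j + 14 ≤ S)
    (hX : ∀ j, 7 ≤ X j) : ¬ (blk (port S d + d.vec) ∈ base S ∨
      ∃ j, blk (port S d + d.vec) ∈ cellStrand S (X j) j) := by
  have e : blk (port S d + d.vec) = match d with
      | .e => (S, 1) | .n => (1, S) | .w => (-1, 1) | .s => (1, -1) := by
    have : ((2 * S - 6).toNat : ℤ) = 2 * S - 6 := Int.toNat_of_nonneg (by omega)
    cases d <;> simp [port, hubPort, arm, Dir.vec, blk, this] <;> omega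
  rw [e]
  rintro (h | ⟨j, h⟩)
  · cases d <;> simp [base] at h <;> omega
  · have := strand_box (hXS j) (hX j) h
    cases d <;> rcases j with ⟨_ | _, _ | _⟩ <;> simp [off, sc] at this

end Geometry

theorem finite_Nrect (m n : ℤ) : (Nrect m n).Finite := by
  refine (Set.finite_Icc ((-m, -n) : Pos) (m, n)).subset fun w hw => ?_
  have h1 := abs_le.1 hw.1
  have h2 := abs_le.1 hw.2.1
  exact ⟨⟨h1.1, h2.1⟩, ⟨h1.2, h2.2⟩⟩

/-- The contents of a square: at most one tile at each of its corners, with matching glues. -/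
def Square (X : Type) (N : Set Pos) : Type :=
  {c : Role → Option (Tile X N) // ∀ j j' t t', c j = some t → c j' = some t' →
    ∀ w (hw : w ∈ N) (hw' : -w ∈ N), off j' = off j + w → t ⟨w, hw⟩ = t' ⟨-w, hw'⟩}

theorem finite_square (X : Type) [Finite X] {N : Set Pos} (hN : N.Finite) :
    Finite (Square X N) := by
  have : Finite {w // w ∈ N} := hN.to_subtype
  exact Subtype.finite

/-- The contents of the square `q` in a tiling. -/
def Square.of {X : Type} {N : Set Pos} {T : Set (Tile X N)} {r : Pos → Option (Tile X N)}
    (hr : IsTiling T r) (q : Pos) : Square X N :=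
  ⟨fun j => r (q + off j), fun j j' t t' h h' w hw hw' e =>
    hr.2 _ t h w t' (by rwa [add_assoc, ← e]) hw hw'⟩

/-- The ways to go through a tile, knowing the contents of the four squares around it. -/
structure Variant {X : Type} {N : Set Pos} (T : Set (Tile X N)) : Type where
  tile : Tile X N
  tile_mem : tile ∈ T
  source : Dir
  target : Dir
  source_ne : source ≠ target
  square : Role → Square X N
  square_self : ∀ j, (square j).1 j = some tile

theorem finite_variant {X : Type} [Finite X] {N : Set Pos} (hN : N.Finite) (T : Set (Tile X N)) :
    Finite (Variant T) := by
  have : Finite {w // w ∈ N} := hN.to_subtype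
  have := finite_square X hN
  refine Finite.of_injective (fun v : Variant T => (v.tile, v.source, v.target, v.square)) ?_
  rintro ⟨t, _, i, o, _, κ, _⟩ ⟨t', _, i', o', _, κ', _⟩ h
  simp only [Prod.mk.injEq] at h
  obtain ⟨rfl, rfl, rfl, rfl⟩ := h
  rfl

theorem getElem_mem_edges {α : Type} {L : List α} {k : ℕ} (h : k + 1 < L.length) :
    (L[k], L[k + 1]) ∈ edges L := by
  induction L generalizing k with
  | nil => simp at h
  | cons a L ih =>
    cases L with
    | nil => simp at h
    | cons b L =>
      cases k with
      | zero => simp [edges]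
      | succ k => exact List.mem_cons_of_mem _ (ih (by simpa using h))

theorem SelfAvoiding.two_le_length {L : List Pos} {p q : Pos} (hp : L.head? = some p)
    (hq : L.getLast? = some q) (hpq : p ≠ q) : 2 ≤ L.length := by
  match L with
  | [] => simp at hp
  | [a] =>
    simp at hp hq
    exact absurd (hp.symm.trans hq) hpq
  | a :: b :: L => simp

section Cell

variable {X : Type} [Finite X] {N : Set Pos} (hN : N.Finite) {T : Set (Tile X N)}

/-- The width of a cell, in blocks. -/
noncomputable def width (X : Type) (N : Set Pos) : ℤ := 7 * (Nat.card (Square X N) : ℤ) + 14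

/-- The abscissa of the bumps encoding a square. -/
noncomputable def abscissa (κ : Square X N) : ℤ :=
  have := finite_square X hN
  7 * (((Finite.equivFin (Square X N)) κ : ℕ) : ℤ) + 7

theorem le_abscissa (κ : Square X N) : 7 ≤ abscissa hN κ := by
  simp only [abscissa]
  omega

theorem abscissa_add_le (κ : Square X N) : abscissa hN κ + 14 ≤ width X N := by
  have := finite_square X hN
  have := ((Finite.equivFin (Square X N)) κ).2
  simp only [abscissa, width]
  omega

theorem abscissa_far {κ κ' : Square X N} (h : κ ≠ κ') :
    abscissa hN κ + 7 ≤ abscissa hN κ' ∨ abscissa hN κ' + 7 ≤ abscissa hN κ := by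
  have := finite_square X hN
  have : ((Finite.equivFin (Square X N)) κ : ℕ) ≠ (Finite.equivFin (Square X N)) κ' :=
    fun e => h ((Finite.equivFin (Square X N)).injective (Fin.ext e))
  simp only [abscissa]
  omega

omit [Finite X] in
theorem le_width : 14 ≤ width X N := by
  simp only [width]
  omega

theorem exists_variantPath (v : Variant T) : ∃ L, IsCrossing (width X N)
    (fun j => abscissa hN (v.square j)) v.source v.target L :=
  exists_isCrossing (fun _ => abscissa_add_le hN _) (fun _ => le_abscissa hN _) v.source_ne

/-- The path of a variant through its cell. -/
noncomputable def variantPath (v : Variant T) : List Pos := (exists_variantPath hN v).choose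

theorem isCrossing_variantPath (v : Variant T) : IsCrossing (width X N)
    (fun j => abscissa hN (v.square j)) v.source v.target (variantPath hN v) :=
  (exists_variantPath hN v).choose_spec

/-- The point where the paths cross the side of a cell in a given direction. -/
noncomputable def gate (S : ℤ) (w : Pos) : Pos :=
  if h : ∃ d : Dir, d.vec = w then port S h.choose else 0

theorem gate_vec (S : ℤ) (d : Dir) : gate S d.vec = port S d := by
  have h : ∃ d' : Dir, d'.vec = d.vec := ⟨d, rfl⟩
  rw [gate, dif_pos h, Dir.vec_injective h.choose_spec]

/-- The paths of all variants. -/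
noncomputable def cells (T : Set (Tile X N)) : CellPaths (Variant T) where
  s := 2 * width X N
  hs := by have := le_width (X := X) (N := N); omega
  inD v := v.source.vec
  outD v := v.target.vec
  st := gate (width X N)
  en := gate (width X N)
  len v := (variantPath hN v).length
  pos v k := (variantPath hN v).getD k 0
  inD_mem v := v.source.vec_mem
  outD_mem v := v.target.vec_mem
  two_le_len v := SelfAvoiding.two_le_length (isCrossing_variantPath hN v).head
    (isCrossing_variantPath hN v).last fun h => v.source_ne (port_injective le_width h)
  pos_zero v := by
    rw [gate_vec, List.getD_eq_getElem?_getD, ← List.head?_eq_getElem?,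
      (isCrossing_variantPath hN v).head]
    rfl
  pos_last v := by
    rw [gate_vec, List.getD_eq_getElem?_getD, ← List.getLast?_eq_getElem?,
      (isCrossing_variantPath hN v).last]
    rfl
  pos_step v k hk := by
    rw [List.getD_eq_getElem _ _ hk, List.getD_eq_getElem _ _ (by omega)]
    exact (isCrossing_variantPath hN v).path.adj _ (getElem_mem_edges hk)
  pos_inj v k l hk hl h := by
    rw [List.getD_eq_getElem _ _ hk, List.getD_eq_getElem _ _ hl] at h
    exact ((isCrossing_variantPath hN v).path.nodup.getElem_inj_iff).1 h
  port d hd := by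
    obtain ⟨d, rfl⟩ := Dir.exists_vec hd
    rw [← Dir.vec_opp, gate_vec, gate_vec, port_add le_width]
  st_out v k hk h := by
    rw [List.getD_eq_getElem _ _ hk, gate_vec] at h
    have := (isCrossing_variantPath hN v).sub _ (List.getElem_mem hk)
    rw [h] at this
    exact blk_port_add le_width (fun _ => abscissa_add_le hN _) (fun _ => le_abscissa hN _) this
  en_out v k hk h := by
    rw [List.getD_eq_getElem _ _ hk, gate_vec] at h
    have := (isCrossing_variantPath hN v).sub _ (List.getElem_mem hk)
    rw [h] at this
    exact blk_port_add le_width (fun _ => abscissa_add_le hN _) (fun _ => le_abscissa hN _) this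
  origin v := by
    obtain ⟨k, hk, e⟩ := List.getElem_of_mem (isCrossing_variantPath hN v).zero
    exact ⟨k, hk, by rw [List.getD_eq_getElem _ _ hk]; exact e⟩

variable {hN}

theorem blk_pos_cells (v : Variant T) {k : ℕ} (hk : k < (cells hN T).len v) :
    blk ((cells hN T).pos v k) ∈ base (width X N) ∨
      ∃ j, blk ((cells hN T).pos v k) ∈ cellStrand (width X N) (abscissa hN (v.square j)) j := by
  refine (isCrossing_variantPath hN v).sub _ ?_
  simp only [cells]
  rw [List.getD_eq_getElem _ _ hk]
  exact List.getElem_mem hk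

theorem exists_pos_cells (v : Variant T) {p : Pos} {j : Role}
    (h : blk p ∈ cellStrand (width X N) (abscissa hN (v.square j)) j) :
    ∃ k < (cells hN T).len v, (cells hN T).pos v k = p := by
  obtain ⟨k, hk, e⟩ := List.getElem_of_mem ((isCrossing_variantPath hN v).sup p j h)
  exact ⟨k, hk, (List.getD_eq_getElem _ _ hk).trans e⟩

end Cell

theorem blk_scale_add (S : ℤ) (u p : Pos) : blk (sc (2 * S) u + p) = sc S u + blk p := by
  simp only [blk, sc, Prod.mk_add_mk, Prod.fst_add, Prod.snd_add, Prod.mk.injEq]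
  constructor <;> rw [mul_assoc, Int.add_comm, Int.add_mul_ediv_left _ _ (by norm_num), add_comm]

theorem sc_sub_add (S : ℤ) (u o b : Pos) : sc S (u - o) + (b + sc S o) = sc S u + b := by
  simp only [sc, Prod.ext_iff, Prod.fst_add, Prod.snd_add, Prod.fst_sub, Prod.snd_sub]
  constructor <;> ring

theorem exists_off {w : Pos} (hw : w ∈ Nrect 1 1) : ∃ j j', off j' = off j + w ∧ j ≠ j' := by
  obtain ⟨h1, h2, h3⟩ := hw
  have h1 := abs_le.1 h1
  have h2 := abs_le.1 h2
  have key : off (decide (w.1 = 1), decide (w.2 = 1)) =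
      off (decide (w.1 = -1), decide (w.2 = -1)) + w := by
    simp only [off, Prod.ext_iff, Prod.fst_add, Prod.snd_add, decide_eq_true_eq]
    constructor <;> split_ifs <;> omega
  refine ⟨_, _, key, fun e => h3 ?_⟩
  rw [e] at key
  exact left_eq_add.1 key

section Cell

variable {X : Type} [Finite X] {N : Set Pos} {hN : N.Finite} {T : Set (Tile X N)}

theorem glue_eq_of_disjoint {w : Pos} (hw₁ : w ∈ Nrect 1 1) (hw : w ∈ N) (hw' : -w ∈ N)
    (v v' : Variant T)
    (h : ∀ k < (cells hN T).len v, ∀ l < (cells hN T).len v',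
      (cells hN T).pos v k ≠ sc (cells hN T).s w + (cells hN T).pos v' l) :
    v.tile ⟨w, hw⟩ = v'.tile ⟨-w, hw'⟩ := by
  obtain ⟨j, j', e, hj⟩ := exists_off hw₁
  by_cases hc : v.square j = v'.square j'
  · refine (v.square j).2 j j' _ _ (v.square_self j) ?_ w hw hw' e
    rw [hc]
    exact v'.square_self j'
  · exfalso
    obtain ⟨q, hq, hq'⟩ := strand_meet (abscissa_add_le hN _) (le_abscissa hN _)
      (abscissa_add_le hN _) (le_abscissa hN _) (abscissa_far hN hc) hj
    have hblk : ∀ b : Pos, blk (sc 2 b) = b := fun b => by simp [blk, sc]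
    obtain ⟨k, hk, ek⟩ := exists_pos_cells (hN := hN) v (p := sc 2 (q - sc (width X N) (off j)))
      (j := j) (by
        rw [hblk, cellStrand, Set.mem_ofPred_eq, sub_add_cancel]
        exact hq)
    obtain ⟨l, hl, el⟩ := exists_pos_cells (hN := hN) v'
      (p := sc 2 (q - sc (width X N) (off j'))) (j := j') (by
        rw [hblk, cellStrand, Set.mem_ofPred_eq, sub_add_cancel]
        exact hq')
    refine h k hk l hl ?_
    rw [ek, el, e]
    simp only [cells, sc, Prod.ext_iff, Prod.fst_add, Prod.snd_add, Prod.fst_sub, Prod.snd_sub]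
    constructor <;> ring

theorem eq_of_meet {u u' : Pos} {v v' : Variant T}
    (h : ∀ j j', u - off j = u' - off j' → v.square j = v'.square j')
    {k l : ℕ} (hk : k < (cells hN T).len v) (hl : l < (cells hN T).len v')
    (e : sc (cells hN T).s u + (cells hN T).pos v k =
      sc (cells hN T).s u' + (cells hN T).pos v' l) : u = u' := by
  have e := congrArg blk e
  change blk (sc (2 * width X N) u + _) = blk (sc (2 * width X N) u' + _) at e
  rw [blk_scale_add, blk_scale_add] at e
  have hX := fun κ : Square X N => le_abscissa hN κ
  have hS := fun κ : Square X N => abscissa_add_le hN κ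
  rcases blk_pos_cells v hk with h1 | ⟨j, h1⟩ <;> rcases blk_pos_cells v' hl with h2 | ⟨j', h2⟩
  · exact base_base le_width h1 h2 e
  · rw [← sc_sub_add _ u' (off j')] at e
    exact absurd e (base_strand (hS _) (hX _) h1 h2)
  · rw [← sc_sub_add _ u (off j)] at e
    exact absurd e.symm (base_strand (hS _) (hX _) h2 h1)
  · rw [← sc_sub_add _ u (off j), ← sc_sub_add _ u' (off j')] at e
    obtain ⟨e1, e2⟩ := strand_strand (hS _) (hX _) (hS _) (hX _) h1 h2 e
    rw [cellStrand, Set.mem_ofPred_eq] at h1 h2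
    rw [e2, h j j' e1] at h1
    obtain rfl := strand_disj (hS _) (hX _) h1 h2
    exact sub_left_injective e1

end Cell

theorem Dir.exists_ne (d : Dir) : ∃ d' : Dir, d' ≠ d := by
  cases d
  exacts [⟨.n, by simp⟩, ⟨.e, by simp⟩, ⟨.e, by simp⟩, ⟨.e, by simp⟩]

/-- Directions of the previous and of the next position along an injective path. -/
theorem exists_directions {I : Set ℤ} {P : ℤ → Pos} (hP : IsPath I P)
    (hinj : ∀ i ∈ I, ∀ j ∈ I, P i = P j → i = j) {i : ℤ} (hi : i ∈ I) :
    ∃ b t : Dir, b ≠ t ∧ (i + 1 ∈ I → P (i + 1) = P i + t.vec) ∧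
      (i - 1 ∈ I → P (i - 1) = P i + b.vec) := by
  have hn : i + 1 ∈ I → ∃ t : Dir, P (i + 1) = P i + t.vec := fun h => by
    obtain ⟨t, ht⟩ := Dir.exists_vec (hP.2 i hi h)
    exact ⟨t, by rw [ht, add_sub_cancel]⟩
  have hp : i - 1 ∈ I → ∃ b : Dir, P (i - 1) = P i + b.vec := fun h => by
    obtain ⟨t, ht⟩ := Dir.exists_vec (hP.2 (i - 1) h (by rwa [sub_add_cancel]))
    refine ⟨t.opp, ?_⟩
    rw [Dir.vec_opp, ht, sub_add_cancel]
    abel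
  by_cases h1 : i + 1 ∈ I <;> by_cases h2 : i - 1 ∈ I
  · obtain ⟨t, ht⟩ := hn h1
    obtain ⟨b, hb⟩ := hp h2
    refine ⟨b, t, ?_, fun _ => ht, fun _ => hb⟩
    rintro rfl
    have := hinj _ h1 _ h2 (ht.trans hb.symm)
    omega
  · obtain ⟨t, ht⟩ := hn h1
    obtain ⟨b, hb⟩ := t.exists_ne
    exact ⟨b, t, hb, fun _ => ht, fun h => absurd h h2⟩
  · obtain ⟨b, hb⟩ := hp h2
    obtain ⟨t, ht⟩ := b.exists_ne
    exact ⟨b, t, ht.symm, fun h => absurd h h1, fun _ => hb⟩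
  · obtain ⟨b, hb⟩ := Dir.e.exists_ne
    exact ⟨b, .e, hb, fun h => absurd h h1, fun h => absurd h h2⟩

theorem exists_variant {X : Type} {N : Set Pos} {T : Set (Tile X N)} {I : Set ℤ} {P : ℤ → Pos}
    {r : Pos → Option (Tile X N)} (h : IsZipper T I P r) {i : ℤ} (hi : i ∈ I) :
    ∃ v : Variant T, r (P i) = some v.tile ∧ (i + 1 ∈ I → P (i + 1) = P i + v.target.vec) ∧
      (i - 1 ∈ I → P (i - 1) = P i + v.source.vec) ∧
      ∀ j, v.square j = Square.of h.2.2 (P i - off j) := by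
  obtain ⟨b, t, hbt, ht, hb⟩ := exists_directions h.1.1 h.2.1 hi
  have hdom : P i ∈ tdom r := by
    rw [h.1.2.1]
    exact ⟨i, hi, rfl⟩
  obtain ⟨a, ha⟩ := Option.ne_none_iff_exists'.1 hdom
  refine ⟨⟨a, h.1.2.2 _ _ ha, b, t, hbt, fun j => Square.of h.2.2 (P i - off j), fun j => ?_⟩,
    ha, ht, hb, fun _ => rfl⟩
  change r (P i - off j + off j) = some a
  rwa [sub_add_cancel]

/-- simulation of Moore-neighborhood zippers by ribbons.
The Moore neighborhood is the rectangular neighborhood `N_{1,1}`. -/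
theorem stmt5 (X : Type) [Fintype X] (T : Set (Tile X (Nrect 1 1)))
    (hT : T.Finite) :
    ∃ (Xμ : Type) (_ : Fintype Xμ) (Tμ : Set (Tile Xμ Nvn)) (_ : Tμ.Finite)
      (s : ℤ) (sim : ZipperSimulation X Xμ (Nrect 1 1) T Tμ s),
      ∀ I P r, IsZipper T I P r → ∃ R : Ribbon Xμ Tμ, sim.chi R ∈ sim.psi I P r := by
  have hN : (Nrect 1 1).Finite := finite_Nrect 1 1
  have hV : Finite (Variant T) := finite_variant hN T
  have hdir : Finite {w // w ∈ Nvn} := finite_Nvn.to_subtype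
  obtain ⟨sim, hsim⟩ := (cells hN T).exists_zipperSimulation (fun v : Variant T => v.tile)
    (fun v => v.tile_mem) (fun w hw hw' v v' => glue_eq_of_disjoint hw hw hw' v v')
    (fun h => h.2.2 rfl) (by
      intro I P r hz hI
      obtain ⟨i₀, hi₀⟩ := hI
      obtain ⟨v₀, -⟩ := exists_variant hz hi₀
      have : Nonempty (Variant T) := ⟨v₀⟩
      choose! v h1 h2 h3 h4 using fun i (hi : i ∈ I) => exists_variant hz hi
      refine ⟨v, h1, fun i hi hi' => ⟨h2 i hi hi', ?_⟩, fun i hi j hj hij k hk l hl e => ?_⟩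
      · have e2 := h2 i hi hi'
        have e3 := h3 (i + 1) hi' (by rwa [add_sub_cancel_right])
        rw [add_sub_cancel_right, e2, add_assoc, left_eq_add] at e3
        exact eq_neg_of_add_eq_zero_right e3
      · refine hij (hz.2.1 i hi j hj (eq_of_meet (fun a b hab => ?_) hk hl e))
        rw [h4 i hi, h4 j hj, hab])
  exact ⟨_, Fintype.ofFinite _, _, Set.finite_range _, _, sim, hsim⟩

end Paper
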